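/- arXiv:2203.08109 — 4 statements merged into one kernel-verified Lean document; each statement's English description precedes it below -/
import Mathlib

section
/- For every integer M ≥ 1, there exist a locally constant function f : O → ℝ and a finite nonempty subset X of O such that V_Taib(f) = 2 and |(1/|X|)·Σ_{x∈X} f(x) − ∫_O f dμ| ≥ 2M·Δ(X). (Consequently no Koksma inequality with constant depending only on the Taibleson variation is possible.) -/
open MeasureTheory Set Filter Topology
open scoped ENNReal NNReal

noncomputable section

namespace NAKoksma

variable (K : Type*) [NontriviallyNormedField K] [IsUltrametricDist K]

/-- The ring of integers `O = {x : K | ‖x‖ ≤ 1}` of a non-Archimedean normed field. -/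
def RoI : Subring K where
  carrier := {x : K | ‖x‖ ≤ 1}
  mul_mem' := fun {a b} ha hb => by
    simp only [Set.mem_setOf_eq] at *
    calc ‖a * b‖ = ‖a‖ * ‖b‖ := norm_mul a b
      _ ≤ 1 * 1 := mul_le_mul ha hb (norm_nonneg b) zero_le_one
      _ = 1 := one_mul 1
  one_mem' := by simp
  add_mem' := fun {a b} ha hb => by
    simp only [Set.mem_setOf_eq] at *
    exact (IsUltrametricDist.norm_add_le_max a b).trans (max_le ha hb)
  zero_mem' := by simp
  neg_mem' := fun {a} ha => by
    simp only [Set.mem_setOf_eq, norm_neg] at *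
    exact ha

variable (q : ℕ)

/-- The disc of radius `q ^ (-n)` centered at `a` in the ring of integers. -/
def disc (a : RoI K) (n : ℕ) : Set (RoI K) :=
  {x : RoI K | ‖(x : K) - (a : K)‖ ≤ (q : ℝ) ^ (-(n : ℤ))}

/-- A subset of `O` is a disc if it is of the form `D_r(a)` with `r = q^(-n)`, `0 < r ≤ 1`. -/
def IsDisc (D : Set (RoI K)) : Prop := ∃ (a : RoI K) (n : ℕ), D = disc K q a n

/-- A Taibleson partition: a finite collection of discs partitioning `O`. -/
def IsTaibPartition (P : Finset (Set (RoI K))) : Prop :=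
  (∀ D ∈ P, IsDisc K q D) ∧ (P : Set (Set (RoI K))).PairwiseDisjoint id ∧
    ⋃₀ (P : Set (Set (RoI K))) = Set.univ

/-- `V_Π(f) = Σ_{D ∈ Π} sup_{x,y ∈ D} (f x - f y)`, valued in `[0,∞]`. -/
def VPi (f : RoI K → ℝ) (P : Finset (Set (RoI K))) : ℝ≥0∞ :=
  ∑ D ∈ P, ⨆ x ∈ D, ⨆ y ∈ D, ENNReal.ofReal (f x - f y)

/-- The Taibleson variation `V_Taib(f) = sup_Π V_Π(f)`. -/
def VTaib (f : RoI K → ℝ) : ℝ≥0∞ :=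
  ⨆ P : {P : Finset (Set (RoI K)) // IsTaibPartition K q P}, VPi K f P.1

variable [MeasurableSpace K]

/-- The discrepancy `Δ(X) = sup_D | |X ∩ D| / |X| - μ(D) |` of a finite set `X ⊆ O`. -/
def discrepancy (μ : Measure (RoI K)) (X : Finset (RoI K)) : ℝ :=
  ⨆ D : {D : Set (RoI K) // IsDisc K q D},
    |(Nat.card ↥((X : Set (RoI K)) ∩ D.1) : ℝ) / (X.card : ℝ) - (μ D.1).toReal|

variable (π : RoI K)

/-- The `i`-th point `m_i = a_0 + a_1 π + ⋯ + a_{λ-1} π^{λ-1}` in the dictionary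
ordering of the coefficient strings `(a_0, …, a_{λ-1})` with respect to the
indexing of the coset representatives `S`. -/
def beerPoint (S : ℕ → RoI K) (lam i : ℕ) : RoI K :=
  ∑ j ∈ Finset.range lam, S (i / q ^ (lam - 1 - j) % q) * π ^ j

/-- `V_λ(f) = sup_{x_i ∈ E_i} Σ_{i=1}^{q^λ - 1} |f(x_i) - f(x_{i-1})|` over the ordered Beer
partition `E_0, …, E_{q^λ - 1}` of level `λ`. -/
def VBeerLevel (S : ℕ → RoI K) (f : RoI K → ℝ) (lam : ℕ) : ℝ≥0∞ :=
  ⨆ x : {x : ℕ → RoI K // ∀ i < q ^ lam, x i ∈ disc K q (beerPoint K q π S lam i) lam},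
    ∑ i ∈ Finset.Ico 1 (q ^ lam), ENNReal.ofReal |f (x.1 i) - f (x.1 (i - 1))|

/-- The Beer variation `V_Beer(f) = lim_{λ→∞} V_λ(f) = sup_{λ ≥ 1} V_λ(f)`. -/
def VBeer (S : ℕ → RoI K) (f : RoI K → ℝ) : ℝ≥0∞ :=
  ⨆ lam : ℕ, VBeerLevel K q π S f (lam + 1)

/-- `S : ℕ → O` (through indices `0, …, q-1`) is a complete ordered system of coset
representatives for the residue field `O/πO`, containing `0`. -/
def IsRepSystem (S : ℕ → RoI K) : Prop :=
  (∃ i, i < q ∧ S i = 0) ∧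
    Function.Bijective fun i : Fin q => Ideal.Quotient.mk (Ideal.span {π}) (S (i : ℕ))

/-- The Berkovich-analytic variation
`V_Berk(f) = Σ_D Σ_{D' ≺ D} |f(D') - f(D)|`, where `D' ≺ D` means `D' ⊆ D` and
`μ(D') = μ(D)/q`, and `f(D)` denotes the average of `f` over `D`. -/
def VBerk (μ : Measure (RoI K)) (f : RoI K → ℝ) : ℝ≥0∞ :=
  ∑' D : {D : Set (RoI K) // IsDisc K q D},
    ∑' D' : {D' : Set (RoI K) // IsDisc K q D' ∧ D' ⊆ D.1 ∧ μ D' = μ D.1 / (q : ℝ≥0∞)},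
      ENNReal.ofReal |(⨍ x in D'.1, f x ∂μ) - ⨍ x in D.1, f x ∂μ|

/-- The level `ℓ(γ)` of a character `γ : O → 𝕋`: the least `ℓ ≥ 0` such that `γ` is trivial
on `π^ℓ O`. -/
def charLevel (γ : AddChar (RoI K) Circle) : ℕ :=
  sInf {l : ℕ | ∀ y : RoI K, γ (π ^ l * y) = 1}

/-- The Fourier coefficient `f̂(γ) = ∫_O f(x) conj(γ(x)) dμ(x)`. -/
def fourierCoeff (μ : Measure (RoI K)) (f : RoI K → ℂ) (γ : AddChar (RoI K) Circle) : ℂ :=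
  ∫ x, f x * (starRingEnd ℂ) ((γ x : Circle) : ℂ) ∂μ

/-- The Fourier-analytic variation `V_Fourier(f) = Σ_{γ ≠ γ₀} q^{ℓ(γ)} |f̂(γ)|`, the sum over
all nontrivial continuous characters of `O`. -/
def VFourier (μ : Measure (RoI K)) (f : RoI K → ℝ) : ℝ≥0∞ :=
  ∑' γ : {γ : AddChar (RoI K) Circle // Continuous ⇑γ ∧ γ ≠ 1},
    ENNReal.ofReal ((q : ℝ) ^ charLevel K π γ.1 * ‖fourierCoeff K μ (fun x => (f x : ℂ)) γ.1‖)

/-- A function is a finite linear combination of characteristic functions of discs. -/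
def IsDiscSimple (g : RoI K → ℝ) : Prop :=
  ∃ (P : Finset (Set (RoI K))) (c : Set (RoI K) → ℝ),
    (∀ D ∈ P, IsDisc K q D) ∧ g = fun x => ∑ D ∈ P, c D * D.indicator 1 x

/-- Integrability in the sense of Beer: `f` can be squeezed between finite linear combinations
of characteristic functions of discs with integrals converging to each other. -/
def BeerIntegrable [MeasurableSpace K] (μ : Measure (RoI K)) (f : RoI K → ℝ) : Prop :=
  ∃ u v : ℕ → RoI K → ℝ,
    (∀ n, IsDiscSimple K q (u n)) ∧ (∀ n, IsDiscSimple K q (v n)) ∧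
    (∀ n x, u n x ≤ f x ∧ f x ≤ v n x) ∧
    Tendsto (fun n => ∫ x, (v n x - u n x) ∂μ) atTop (𝓝 0)

variable [LocallyCompactSpace K] [BorelSpace K]

/-! ### Digit strings and signs -/

/-- The function on digits equal to `1` at `0`, to `-1` at `1`, and to `0` elsewhere. -/
def digitSign {q : ℕ} (r : Fin q) : ℤ :=
  if r.val = 0 then 1 else if r.val = 1 then -1 else 0

theorem abs_digitSign_le {q : ℕ} (r : Fin q) : |digitSign r| ≤ 1 := by
  unfold digitSign
  split_ifs <;> simp

theorem sum_digitSign_mul_eq_zero {q N : ℕ} (hq : 1 < q) (i : Fin N)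
    (F : (Fin N → Fin q) → ℝ) (hF : ∀ a r, F (Function.update a i r) = F a) :
    ∑ a, (digitSign (a i) : ℝ) * F a = 0 := by
  have hswap : ∀ r : Fin q,
      digitSign (Equiv.swap (⟨0, by omega⟩ : Fin q) ⟨1, hq⟩ r) = -digitSign r := by
    intro r
    unfold digitSign
    rw [Equiv.swap_apply_def]
    split_ifs <;> simp_all [Fin.ext_iff]
  have hinv : Function.Involutive fun a : Fin N → Fin q =>
      Function.update a i (Equiv.swap (⟨0, by omega⟩ : Fin q) ⟨1, hq⟩ (a i)) := by
    intro a
    simp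
  have h := Equiv.sum_comp hinv.toPerm fun a => (digitSign (a i) : ℝ) * F a
  simp only [Function.Involutive.coe_toPerm, hF, Function.update_self, hswap, Int.cast_neg,
    neg_mul, Finset.sum_neg_distrib] at h
  linarith

theorem sum_digitSign_sq {q N : ℕ} (hq : 1 < q) (i : Fin N) :
    ∑ a : Fin N → Fin q, (digitSign (a i) : ℝ) * digitSign (a i) = 2 * (q : ℝ) ^ (N - 1) := by
  have hone : ∑ r : Fin q, (digitSign r : ℝ) * digitSign r = 2 := by
    obtain ⟨k, rfl⟩ : ∃ k, q = k + 2 := ⟨q - 2, by omega⟩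
    rw [Fin.sum_univ_succ, Fin.sum_univ_succ]
    norm_num [digitSign]
  calc ∑ a : Fin N → Fin q, (digitSign (a i) : ℝ) * digitSign (a i)
      = ∑ a : Fin N → Fin q,
          ∏ j, if j = i then (digitSign (a j) : ℝ) * digitSign (a j) else 1 := by
        simp
    _ = ∏ j : Fin N, ∑ r : Fin q, if j = i then (digitSign r : ℝ) * digitSign r else 1 := by
        rw [Finset.prod_univ_sum, Fintype.piFinset_univ]
    _ = ∏ j : Fin N, if j = i then (2 : ℝ) else q := by
        refine Finset.prod_congr rfl fun j _ => ?_
        split_ifs <;> simp [hone]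
    _ = 2 * (q : ℝ) ^ (N - 1) := by
        rw [← Finset.mul_prod_erase _ _ (Finset.mem_univ i), if_pos rfl,
          Finset.prod_congr rfl fun j hj => if_neg (Finset.ne_of_mem_erase hj)]
        simp [Finset.card_erase_of_mem]

/-- The signed excess `∑ χ(a_i) q ^ i` of a digit string. -/
def excess {q N : ℕ} (a : Fin N → Fin q) : ℤ := ∑ i, digitSign (a i) * (q : ℤ) ^ (i : ℕ)

/-- The weighted sum of signs `∑ χ(a_j) q ^ (-j)` of a digit string. -/
def weightedSign {q N : ℕ} (a : Fin N → Fin q) : ℝ :=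
  ∑ j, (digitSign (a j) : ℝ) * ((q : ℝ)⁻¹) ^ (j : ℕ)

theorem geom_sum_le_pow {q : ℕ} (hq : 1 < q) (n : ℕ) :
    ∑ i ∈ Finset.range n, (q : ℝ) ^ i ≤ (q : ℝ) ^ n := by
  exact_mod_cast (Nat.geomSum_lt (s := Finset.range n) (n := n) hq (by simp)).le

theorem abs_sum_digitSign_le {q N n : ℕ} (hq : 1 < q) (hn : n ≤ N) (a : Fin N → Fin q) :
    |∑ i : Fin N, if (i : ℕ) < n then (digitSign (a i) : ℝ) * (q : ℝ) ^ (i : ℕ) else 0|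
      ≤ (q : ℝ) ^ n := by
  calc _ ≤ ∑ i : Fin N, if (i : ℕ) < n then (q : ℝ) ^ (i : ℕ) else 0 := by
        refine (Finset.abs_sum_le_sum_abs _ _).trans (Finset.sum_le_sum fun i _ => ?_)
        split_ifs
        · rw [abs_mul, abs_of_nonneg (by positivity : (0 : ℝ) ≤ (q : ℝ) ^ (i : ℕ))]
          refine mul_le_of_le_one_left (by positivity) ?_
          exact_mod_cast abs_digitSign_le (a i)
        · simp
    _ = ∑ i ∈ Finset.range n, (q : ℝ) ^ i := by
        rw [Fin.sum_univ_eq_sum_range (fun i => if i < n then (q : ℝ) ^ i else 0),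
          ← Finset.sum_filter]
        congr 1
        ext i
        simp
        omega
    _ ≤ _ := geom_sum_le_pow hq n

theorem abs_excess_le {q N : ℕ} (hq : 1 < q) (a : Fin N → Fin q) :
    |(excess a : ℝ)| ≤ (q : ℝ) ^ N := by
  simpa [excess] using abs_sum_digitSign_le hq le_rfl a

theorem sum_pow_add_excess {q N : ℕ} (hq : 1 < q) :
    ∑ a : Fin N → Fin q, ((q : ℝ) ^ N + excess a) = (q : ℝ) ^ N * (q : ℝ) ^ N := by
  have h : ∑ a : Fin N → Fin q, (excess a : ℝ) = 0 := by
    simp only [excess, Int.cast_sum, Int.cast_mul, Int.cast_pow, Int.cast_natCast]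
    rw [Finset.sum_comm]
    exact Finset.sum_eq_zero fun i _ =>
      sum_digitSign_mul_eq_zero hq i (fun _ => (q : ℝ) ^ (i : ℕ)) fun _ _ => rfl
  rw [Finset.sum_add_distrib, h]
  simp

theorem sum_weightedSign {q N : ℕ} (hq : 1 < q) :
    ∑ a : Fin N → Fin q, weightedSign a = 0 := by
  unfold weightedSign
  rw [Finset.sum_comm]
  exact Finset.sum_eq_zero fun i _ =>
    sum_digitSign_mul_eq_zero hq i (fun _ => ((q : ℝ)⁻¹) ^ (i : ℕ)) fun _ _ => rfl

theorem sum_pow_add_excess_mul_weightedSign {q N : ℕ} (hq : 1 < q) :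
    ∑ a : Fin N → Fin q, ((q : ℝ) ^ N + excess a) * weightedSign a
      = 2 * N * (q : ℝ) ^ (N - 1) := by
  have hq0 : (q : ℝ) ≠ 0 := by positivity
  have hpair : ∀ i j : Fin N, ∑ a : Fin N → Fin q,
      ((digitSign (a i) : ℝ) * (q : ℝ) ^ (i : ℕ)) *
        ((digitSign (a j) : ℝ) * ((q : ℝ)⁻¹) ^ (j : ℕ))
      = if i = j then 2 * (q : ℝ) ^ (N - 1) else 0 := by
    intro i j
    split_ifs with hij
    · subst hij
      rw [← sum_digitSign_sq hq i]
      refine Finset.sum_congr rfl fun a _ => ?_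
      rw [inv_pow]
      field_simp
    · rw [← sum_digitSign_mul_eq_zero hq i (fun a => (q : ℝ) ^ (i : ℕ) *
        ((digitSign (a j) : ℝ) * ((q : ℝ)⁻¹) ^ (j : ℕ))) (fun a r => by
          simp [Function.update_of_ne (Ne.symm hij)])]
      exact Finset.sum_congr rfl fun a _ => by ring
  have hexp : ∑ a : Fin N → Fin q, (excess a : ℝ) * weightedSign a =
      ∑ i : Fin N, ∑ j : Fin N, ∑ a : Fin N → Fin q,
        ((digitSign (a i) : ℝ) * (q : ℝ) ^ (i : ℕ)) *
          ((digitSign (a j) : ℝ) * ((q : ℝ)⁻¹) ^ (j : ℕ)) := by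
    simp only [excess, Int.cast_sum, Int.cast_mul, Int.cast_pow, Int.cast_natCast, weightedSign,
      Finset.sum_mul_sum]
    rw [Finset.sum_comm]
    exact Finset.sum_congr rfl fun i _ => Finset.sum_comm
  simp only [add_mul, Finset.sum_add_distrib, ← Finset.mul_sum, sum_weightedSign hq, hexp, hpair,
    Finset.sum_ite_eq, Finset.mem_univ, if_true, Finset.sum_const, Finset.card_univ,
    Fintype.card_fin, nsmul_eq_mul]
  ring

open Classical in
theorem sum_leading_pow_add_excess {q N n : ℕ} (hq : 1 < q) (p : ℕ → Fin q) :
    ∑ a : Fin N → Fin q,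
      ((q : ℝ) ^ N + excess a) * (if ∀ i : Fin N, (i : ℕ) < n → a i = p i then 1 else 0)
    = ((q : ℝ) ^ N + ∑ i : Fin N, if (i : ℕ) < n then
          (digitSign (p i) : ℝ) * (q : ℝ) ^ (i : ℕ) else 0) *
        ∑ a : Fin N → Fin q, if ∀ i : Fin N, (i : ℕ) < n → a i = p i then (1 : ℝ) else 0 := by
  simp only [add_mul, Finset.sum_add_distrib, ← Finset.mul_sum]
  congr 1
  simp only [excess, Int.cast_sum, Int.cast_mul, Int.cast_pow, Int.cast_natCast, Finset.sum_mul]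
  rw [Finset.sum_comm]
  refine Finset.sum_congr rfl fun i _ => ?_
  split_ifs with hi
  · rw [Finset.mul_sum]
    refine Finset.sum_congr rfl fun a _ => ?_
    split_ifs with ha
    · rw [ha i hi]
    · simp
  · rw [zero_mul]
    refine Eq.trans ?_ (sum_digitSign_mul_eq_zero hq i (fun a => (q : ℝ) ^ (i : ℕ) *
      (if ∀ i : Fin N, (i : ℕ) < n → a i = p i then 1 else 0)) fun a r => ?_)
    · exact Finset.sum_congr rfl fun a _ => mul_assoc _ _ _
    · have : (∀ j : Fin N, (j : ℕ) < n → Function.update a i r j = p j) ↔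
          ∀ j : Fin N, (j : ℕ) < n → a j = p j := by
        refine forall_congr' fun j => imp_congr_right fun hj => ?_
        rw [Function.update_of_ne]
        rintro rfl
        exact hi hj
      simp only [this]

theorem weightedSign_sub_le {q N n : ℕ} (hq : 1 < q) (a b : Fin N → Fin q)
    (hab : ∀ i : Fin N, (i : ℕ) < n → a i = b i) :
    weightedSign a - weightedSign b ≤
      2 * ((q : ℝ)⁻¹) ^ n * ∑ j ∈ Finset.range N, ((q : ℝ)⁻¹) ^ j := by
  have hsign : ∀ r : Fin q, (digitSign r : ℝ) ≤ 1 ∧ -1 ≤ (digitSign r : ℝ) := fun r => by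
    have := abs_le.1 (abs_digitSign_le r)
    exact ⟨by exact_mod_cast this.2, by exact_mod_cast this.1⟩
  have htail : ∑ j ∈ Finset.range N, (if j < n then 0 else ((q : ℝ)⁻¹) ^ j) ≤
      ((q : ℝ)⁻¹) ^ n * ∑ j ∈ Finset.range N, ((q : ℝ)⁻¹) ^ j := by
    rcases le_total N n with h | h
    · rw [Finset.sum_eq_zero fun j hj => if_pos ((Finset.mem_range.1 hj).trans_le h)]
      positivity
    · obtain ⟨k, rfl⟩ := Nat.exists_eq_add_of_le h
      rw [Finset.sum_range_add, Finset.sum_eq_zero fun j hj => if_pos (Finset.mem_range.1 hj),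
        zero_add, Finset.mul_sum]
      simp only [Nat.not_lt.2 (Nat.le_add_right _ _), if_false, pow_add]
      exact Finset.sum_le_sum_of_subset_of_nonneg
        (Finset.range_mono (Nat.le_add_left _ _)) fun _ _ _ => by positivity
  calc weightedSign a - weightedSign b
      ≤ ∑ j : Fin N, 2 * (if (j : ℕ) < n then 0 else ((q : ℝ)⁻¹) ^ (j : ℕ)) := by
        rw [weightedSign, weightedSign, ← Finset.sum_sub_distrib]
        refine Finset.sum_le_sum fun j _ => ?_
        split_ifs with hj
        · simp [hab j hj]
        · have hpos : 0 ≤ ((q : ℝ)⁻¹) ^ (j : ℕ) := by positivity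
          nlinarith [(hsign (a j)).1, (hsign (b j)).2]
    _ = 2 * ∑ j ∈ Finset.range N, (if j < n then 0 else ((q : ℝ)⁻¹) ^ j) := by
        rw [← Finset.mul_sum,
          Fin.sum_univ_eq_sum_range (fun j => if j < n then 0 else ((q : ℝ)⁻¹) ^ j)]
    _ ≤ _ := by rw [mul_assoc]; gcongr

/-! ### Digit expansions in the ring of integers -/

/-- A system of digit maps on the ring of integers: the discs are the sets of prescribed leading
digits, and all finite digit strings occur. -/
structure IsDigitSystem {F : Type*} [NontriviallyNormedField F] [IsUltrametricDist F] {q : ℕ}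
    (dig : RoI F → ℕ → Fin q) : Prop where
  mem_disc_iff : ∀ (n : ℕ) (x y : RoI F), x ∈ disc F q y n ↔ ∀ i < n, dig x i = dig y i
  exists_digits : ∀ (n : ℕ) (a : ℕ → Fin q), ∃ x, ∀ i < n, dig x i = a i

theorem exists_isDigitSystem {F : Type*} [NontriviallyNormedField F] [IsUltrametricDist F]
    {q : ℕ} {ϖ : RoI F} (hq : 1 < q) (hϖ : ‖(ϖ : F)‖ = (q : ℝ)⁻¹)
    (hres : Nat.card (↥(RoI F) ⧸ (Ideal.span {ϖ} : Ideal ↥(RoI F))) = q) :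
    ∃ dig : RoI F → ℕ → Fin q, IsDigitSystem dig := by
  have hq0 : (0 : ℝ) < q := by positivity
  have hϖ0 : (ϖ : F) ≠ 0 := norm_ne_zero_iff.1 (by rw [hϖ]; positivity)
  have : Finite (↥(RoI F) ⧸ (Ideal.span {ϖ} : Ideal ↥(RoI F))) :=
    Nat.finite_of_card_ne_zero (by omega)
  let e := Finite.equivFinOfCardEq hres
  let d : RoI F → Fin q := fun x => e (Ideal.Quotient.mk _ x)
  have hd : ∀ x y, d x = d y ↔ ϖ ∣ x - y := fun x y => by
    rw [e.injective.eq_iff, Ideal.Quotient.eq, Ideal.mem_span_singleton]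
  obtain ⟨s, hs⟩ : ∃ s : Fin q → RoI F, ∀ r, d (s r) = r := by
    have hsurj : Function.Surjective d := e.surjective.comp Ideal.Quotient.mk_surjective
    exact ⟨Function.surjInv hsurj, Function.surjInv_eq hsurj⟩
  have hT : ∀ x, ∃ t, x = s (d x) + ϖ * t := fun x => by
    obtain ⟨t, ht⟩ := (hd x (s (d x))).1 (hs _).symm
    exact ⟨t, by rw [← ht]; ring⟩
  choose T hT using hT
  have hcons : ∀ r x, d (s r + ϖ * x) = r ∧ T (s r + ϖ * x) = x := fun r x => by
    have h1 : d (s r + ϖ * x) = r := by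
      rw [← hs r, hd, hs]
      simp
    refine ⟨h1, ?_⟩
    have h2 := hT (s r + ϖ * x)
    rw [h1] at h2
    have h3 : (ϖ : RoI F) ≠ 0 := fun h => hϖ0 (by simp [h])
    exact (mul_left_cancel₀ h3 (add_left_cancel h2)).symm
  refine ⟨fun x i => d (T^[i] x), fun n => ?_, fun n => ?_⟩
  · induction n with
    | zero =>
      intro x y
      have hxy : ‖(x : F) - y‖ ≤ 1 := (x - y).2
      simpa [disc] using hxy
    | succ n ih =>
      intro x y
      have key : d x = d y → (x ∈ disc F q y (n + 1) ↔ T x ∈ disc F q (T y) n) := fun h => by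
        have hxy : (x : F) - y = ϖ * ((T x : F) - T y) := by
          have := congrArg (Subtype.val) (show x - y = ϖ * (T x - T y) by
            conv_lhs => rw [hT x, hT y, h]
            ring)
          simpa using this
        simp only [disc, Set.mem_ofPred_eq]
        rw [hxy, norm_mul, hϖ, zpow_neg, zpow_neg, zpow_natCast, zpow_natCast, pow_succ,
          mul_inv, mul_comm _ (q : ℝ)⁻¹, mul_le_mul_iff_right₀ (by positivity)]
      have hdisc : x ∈ disc F q y (n + 1) → d x = d y := fun h => by
        rw [hd]
        have hle : ‖((x : F) - y) / ϖ‖ ≤ 1 := by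
          rw [norm_div, hϖ, div_le_one (by positivity)]
          refine h.trans ?_
          rw [zpow_neg, zpow_natCast]
          exact inv_anti₀ hq0 (le_self_pow₀ (by exact_mod_cast hq.le) (by omega))
        refine ⟨⟨((x : F) - y) / ϖ, hle⟩, Subtype.ext ?_⟩
        simp only [Subring.coe_mul, AddSubgroupClass.coe_sub]
        field_simp
      rw [Nat.forall_lt_succ_left']
      simp only [Function.iterate_succ, Function.comp, Function.iterate_zero, id]
      constructor
      · exact fun h => ⟨hdisc h, (ih _ _).1 ((key (hdisc h)).1 h)⟩
      · exact fun h => (key h.1).2 ((ih _ _).2 h.2)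
  · induction n with
    | zero => exact fun a => ⟨0, by simp⟩
    | succ n ih =>
      intro a
      obtain ⟨x, hx⟩ := ih fun i => a (i + 1)
      refine ⟨s (a 0) + ϖ * x, ?_⟩
      rw [Nat.forall_lt_succ_left']
      simp only [Function.iterate_succ, Function.comp, Function.iterate_zero, id,
        (hcons _ _).1, (hcons _ _).2]
      exact ⟨trivial, hx⟩

theorem disc_infinite {F : Type*} [NontriviallyNormedField F] [IsUltrametricDist F]
    {q : ℕ} {ϖ : RoI F} (hq : 1 < q) (hϖ : ‖(ϖ : F)‖ = (q : ℝ)⁻¹) (y : RoI F) (n : ℕ) :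
    (disc F q y n).Infinite := by
  have hq1 : (1 : ℝ) < q := by exact_mod_cast hq
  refine Set.infinite_of_injective_forall_mem (f := fun b : ℕ => y + ϖ ^ (n + b)) ?_ fun b => ?_
  · intro b c h
    have h1 : ‖(ϖ : F) ^ (n + b)‖ = ‖(ϖ : F) ^ (n + c)‖ := by
      have := congrArg Subtype.val (add_left_cancel h)
      simp only [Subring.coe_pow] at this
      rw [this]
    rw [norm_pow, norm_pow, hϖ, inv_pow, inv_pow, inv_inj] at h1
    have := pow_right_injective₀ (by positivity) hq1.ne' h1
    omega
  · simp only [disc, Set.mem_ofPred_eq, Subring.coe_add, Subring.coe_pow, add_sub_cancel_left,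
      norm_pow, hϖ, inv_pow, zpow_neg, zpow_natCast]
    exact inv_anti₀ (by positivity) (pow_le_pow_right₀ hq1.le (by omega))

theorem measurableSet_disc {F : Type*} [NontriviallyNormedField F] [IsUltrametricDist F]
    [MeasurableSpace F] [BorelSpace F] (q : ℕ) (y : RoI F) (n : ℕ) :
    MeasurableSet (disc F q y n) :=
  (isClosed_le (by fun_prop) continuous_const).measurableSet

theorem IsDigitSystem.isLocallyConstant {F : Type*} [NontriviallyNormedField F]
    [IsUltrametricDist F] {q N : ℕ} {dig : RoI F → ℕ → Fin q} (hdig : IsDigitSystem dig)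
    (hq : 1 < q) {β : Type*} (G : (Fin N → Fin q) → β) :
    IsLocallyConstant fun x => G fun i : Fin N => dig x i := by
  rw [IsLocallyConstant.iff_eventually_eq]
  intro x
  filter_upwards [Metric.ball_mem_nhds x (show (0 : ℝ) < (q : ℝ) ^ (-(N : ℤ)) by positivity)]
    with y hy
  have hyx : y ∈ disc F q x N := by
    rw [Metric.mem_ball, Subtype.dist_eq, dist_eq_norm] at hy
    exact hy.le
  rw [hdig.mem_disc_iff] at hyx
  exact congrArg G (funext fun i => hyx i i.2)

theorem IsDigitSystem.exists_fiber_eq_disc {F : Type*} [NontriviallyNormedField F]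
    [IsUltrametricDist F] {q n : ℕ} {dig : RoI F → ℕ → Fin q} (hdig : IsDigitSystem dig)
    (hq : 1 < q) (a : Fin n → Fin q) :
    ∃ y, disc F q y n = {x | (fun i : Fin n => dig x i) = a} := by
  obtain ⟨y, hy⟩ := hdig.exists_digits n fun i => if h : i < n then a ⟨i, h⟩ else ⟨0, by omega⟩
  refine ⟨y, Set.ext fun x => ?_⟩
  rw [hdig.mem_disc_iff, Set.mem_ofPred_eq, funext_iff]
  refine ⟨fun h i => ?_, fun h i hi => ?_⟩
  · rw [h i i.2, hy i i.2, dif_pos i.2]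
  · rw [hy i hi, dif_pos hi, ← h ⟨i, hi⟩]

theorem IsDigitSystem.measure_disc {F : Type*} [NontriviallyNormedField F]
    [IsUltrametricDist F] [MeasurableSpace F] [BorelSpace F] {q : ℕ}
    {dig : RoI F → ℕ → Fin q} (hdig : IsDigitSystem dig) (hq : 1 < q)
    (μ : Measure (RoI F)) [IsProbabilityMeasure μ] [μ.IsAddLeftInvariant]
    (y : RoI F) (n : ℕ) : μ (disc F q y n) = ((q : ℝ≥0∞) ^ n)⁻¹ := by
  have htrans : ∀ z, μ (disc F q z n) = μ (disc F q 0 n) := fun z => by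
    rw [← measure_preimage_add μ z (disc F q z n)]
    congr 1
    ext x
    simp [disc]
  choose c hc using fun a : Fin n → Fin q => hdig.exists_fiber_eq_disc hq a
  have hunion : (⋃ a, disc F q (c a) n) = Set.univ := by
    ext x
    simp [hc]
  have hdisj : Pairwise (Function.onFun Disjoint fun a => disc F q (c a) n) := by
    intro a b hab
    simp only [Function.onFun, hc]
    exact Set.disjoint_left.2 fun x hx hx' => hab (hx.symm.trans hx')
  have h := measure_iUnion (μ := μ) hdisj fun a => measurableSet_disc q (c a) n
  rw [hunion, measure_univ, tsum_fintype] at h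
  simp only [htrans, Finset.sum_const, Finset.card_univ, Fintype.card_pi_const, Fintype.card_fin,
    nsmul_eq_mul, Nat.cast_pow] at h
  rw [htrans y]
  exact ENNReal.eq_inv_of_mul_eq_one_left (by rw [mul_comm]; exact h.symm)

theorem IsDigitSystem.integral_comp {F : Type*} [NontriviallyNormedField F]
    [IsUltrametricDist F] [MeasurableSpace F] [BorelSpace F] {q N : ℕ}
    {dig : RoI F → ℕ → Fin q} (hdig : IsDigitSystem dig) (hq : 1 < q)
    (μ : Measure (RoI F)) [IsProbabilityMeasure μ] [μ.IsAddLeftInvariant]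
    (G : (Fin N → Fin q) → ℝ) :
    ∫ x, G (fun i : Fin N => dig x i) ∂μ = ((q : ℝ) ^ N)⁻¹ * ∑ a, G a := by
  choose c hc using fun a : Fin N → Fin q => hdig.exists_fiber_eq_disc hq a
  have hG : ∀ x, G (fun i : Fin N => dig x i) =
      ∑ a, (disc F q (c a) N).indicator (fun _ => G a) x := fun x => by
    classical
    simp [hc, Set.indicator_apply]
  simp_rw [hG]
  rw [integral_finsetSum _ fun a _ =>
    (integrable_const (G a)).indicator (measurableSet_disc q (c a) N), Finset.mul_sum]
  refine Finset.sum_congr rfl fun a _ => ?_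
  rw [integral_indicator_const _ (measurableSet_disc q (c a) N), Measure.real,
    hdig.measure_disc hq]
  simp

theorem IsDigitSystem.VTaib_eq_two {F : Type*} [NontriviallyNormedField F]
    [IsUltrametricDist F] [MeasurableSpace F] [BorelSpace F] {q N : ℕ}
    {dig : RoI F → ℕ → Fin q} (hdig : IsDigitSystem dig) (hq : 1 < q) (hN : 0 < N)
    (μ : Measure (RoI F)) [IsProbabilityMeasure μ] [μ.IsAddLeftInvariant] :
    VTaib F q (fun x => (∑ j ∈ Finset.range N, ((q : ℝ)⁻¹) ^ j)⁻¹ *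
      weightedSign fun i : Fin N => dig x i) = 2 := by
  set S : ℝ := ∑ j ∈ Finset.range N, ((q : ℝ)⁻¹) ^ j with hS
  have hSpos : 0 < S := Finset.sum_pos (fun _ _ => by positivity) ⟨0, by simpa using hN⟩
  apply le_antisymm
  · refine iSup_le fun ⟨P, hP, hdisj, hcover⟩ => ?_
    calc VPi F _ P ≤ ∑ D ∈ P, 2 * μ D := by
          refine Finset.sum_le_sum fun D hD => ?_
          obtain ⟨y, n, rfl⟩ := hP D hD
          refine iSup₂_le fun u hu => iSup₂_le fun v hv => ?_
          rw [hdig.mem_disc_iff] at hu hv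
          have h := weightedSign_sub_le (n := n) hq (fun i : Fin N => dig u i)
            (fun i : Fin N => dig v i) fun i hi => (hu i hi).trans (hv i hi).symm
          have hbound : S⁻¹ * weightedSign (fun i : Fin N => dig u i) -
              S⁻¹ * weightedSign (fun i : Fin N => dig v i) ≤ 2 * ((q : ℝ) ^ n)⁻¹ := by
            rw [← mul_sub, inv_mul_le_iff₀ hSpos, ← inv_pow]
            linarith
          refine (ENNReal.ofReal_le_ofReal hbound).trans_eq ?_
          rw [hdig.measure_disc hq, ENNReal.ofReal_mul zero_le_two,
            ENNReal.ofReal_inv_of_pos (by positivity), ENNReal.ofReal_pow (by positivity)]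
          simp
      _ = 2 := by
          have h := measure_biUnion_finset (μ := μ) (f := id) hdisj fun D hD => by
            obtain ⟨y, n, rfl⟩ := hP D hD
            exact measurableSet_disc q y n
          have hunion : (⋃ D ∈ P, id D) = Set.univ := by
            rw [← hcover, Set.sUnion_eq_biUnion]
            rfl
          rw [hunion, measure_univ] at h
          simp only [id] at h
          rw [← Finset.mul_sum, ← h, mul_one]
  · have huniv : disc F q 0 0 = Set.univ := by
      ext x
      simp [hdig.mem_disc_iff]
    have hpart : IsTaibPartition F q {Set.univ} := by
      refine ⟨fun D hD => ⟨0, 0, ?_⟩, by simp, by simp⟩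
      rw [Finset.mem_singleton.1 hD, huniv]
    refine le_iSup_of_le ⟨{Set.univ}, hpart⟩ ?_
    obtain ⟨u, hu⟩ := hdig.exists_digits N fun _ => ⟨0, by omega⟩
    obtain ⟨v, hv⟩ := hdig.exists_digits N fun _ => ⟨1, hq⟩
    have hwu : weightedSign (fun i : Fin N => dig u i) = S := by
      rw [weightedSign, hS, ← Fin.sum_univ_eq_sum_range]
      exact Finset.sum_congr rfl fun i _ => by simp [hu i i.2, digitSign]
    have hwv : weightedSign (fun i : Fin N => dig v i) = -S := by
      rw [weightedSign, hS, ← Fin.sum_univ_eq_sum_range, ← Finset.sum_neg_distrib]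
      exact Finset.sum_congr rfl fun i _ => by simp [hv i i.2, digitSign]
    rw [VPi, Finset.sum_singleton]
    refine le_iSup₂_of_le u (Set.mem_univ u) (le_iSup₂_of_le v (Set.mem_univ v) ?_)
    rw [hwu, hwv, mul_neg, inv_mul_cancel₀ hSpos.ne']
    norm_num

open Classical in
theorem IsDigitSystem.exists_finset_card_fiber {F : Type*} [NontriviallyNormedField F]
    [IsUltrametricDist F] {q : ℕ} {ϖ : RoI F} {dig : RoI F → ℕ → Fin q}
    (hdig : IsDigitSystem dig) (hq : 1 < q) (hϖ : ‖(ϖ : F)‖ = (q : ℝ)⁻¹) (N : ℕ)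
    (m : (Fin N → Fin q) → ℕ) :
    ∃ X : Finset (RoI F), ∀ a, (X.filter fun x => (fun i : Fin N => dig x i) = a).card = m a := by
  have hT : ∀ a : Fin N → Fin q, ∃ T : Finset (RoI F),
      (∀ x ∈ T, (fun i : Fin N => dig x i) = a) ∧ T.card = m a := fun a => by
    obtain ⟨y, hy⟩ := hdig.exists_fiber_eq_disc hq a
    obtain ⟨T, hT, hcard⟩ := (disc_infinite hq hϖ y N).exists_subset_card_eq (m a)
    exact ⟨T, fun x hx => by simpa [hy] using hT hx, hcard⟩
  choose T hT hcard using hT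
  refine ⟨Finset.univ.biUnion T, fun a => ?_⟩
  rw [← hcard a]
  congr 1
  ext x
  simp only [Finset.mem_filter, Finset.mem_biUnion, Finset.mem_univ, true_and]
  constructor
  · rintro ⟨⟨b, hb⟩, rfl⟩
    rwa [← hT b x hb] at hb
  · exact fun hx => ⟨⟨a, hx⟩, hT a x hx⟩

theorem sum_comp_eq_sum_card_fiber_mul {ι κ : Type*} [Fintype κ] [DecidableEq κ]
    (X : Finset ι) (d : ι → κ)
    (G : κ → ℝ) : ∑ x ∈ X, G (d x) = ∑ a, ((X.filter fun x => d x = a).card : ℝ) * G a := by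
  rw [← Finset.sum_fiberwise X d]
  refine Finset.sum_congr rfl fun a _ => ?_
  rw [Finset.sum_congr rfl fun x hx => by rw [(Finset.mem_filter.1 hx).2]]
  simp

open Classical in
theorem IsDigitSystem.discrepancy_le {F : Type*} [NontriviallyNormedField F]
    [IsUltrametricDist F] [MeasurableSpace F] [BorelSpace F] {q N : ℕ}
    {dig : RoI F → ℕ → Fin q} (hdig : IsDigitSystem dig) (hq : 1 < q)
    (μ : Measure (RoI F)) [IsProbabilityMeasure μ] [μ.IsAddLeftInvariant]
    {X : Finset (RoI F)} (hcard : (X.card : ℝ) = (q : ℝ) ^ N * (q : ℝ) ^ N)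
    (hX : ∀ a, ((X.filter fun x => (fun i : Fin N => dig x i) = a).card : ℝ) =
      (q : ℝ) ^ N + excess a) :
    discrepancy F q μ X ≤ 2 * ((q : ℝ) ^ N)⁻¹ := by
  have hQ : (0 : ℝ) < (q : ℝ) ^ N := by positivity
  have : Nonempty {D : Set (RoI F) // IsDisc F q D} := ⟨⟨_, 0, 0, rfl⟩⟩
  refine ciSup_le ?_
  rintro ⟨_, y, n, rfl⟩
  have hcount : Nat.card ↥((X : Set (RoI F)) ∩ disc F q y n) =
      (X.filter fun x => x ∈ disc F q y n).card := by
    rw [Nat.card_coe_set_eq, ← Set.ncard_coe_finset, Finset.coe_filter]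
    rfl
  have hμ : (μ (disc F q y n)).toReal = ((q : ℝ) ^ n)⁻¹ := by
    rw [hdig.measure_disc hq]
    simp
  dsimp only
  rw [hcount, hμ, hcard]
  rcases le_total n N with hn | hn
  · have hmem : ∀ x, x ∈ disc F q y n ↔ ∀ i : Fin N, (i : ℕ) < n → dig x i = dig y i :=
      fun x => by
        rw [hdig.mem_disc_iff]
        exact ⟨fun h i hi => h i hi, fun h i hi => h ⟨i, hi.trans_le hn⟩ hi⟩
    have hstrings : ∑ a : Fin N → Fin q,
        (if ∀ i : Fin N, (i : ℕ) < n → a i = dig y i then (1 : ℝ) else 0) =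
          (q : ℝ) ^ N * ((q : ℝ) ^ n)⁻¹ := by
      have h := hdig.integral_comp hq μ fun a : Fin N → Fin q =>
        if ∀ i : Fin N, (i : ℕ) < n → a i = dig y i then (1 : ℝ) else 0
      simp only [← hmem] at h
      have hind : ∫ x, (if x ∈ disc F q y n then (1 : ℝ) else 0) ∂μ = ((q : ℝ) ^ n)⁻¹ := by
        rw [← hμ, ← Measure.real, ← integral_indicator_one (measurableSet_disc q y n)]
        simp [Set.indicator_apply]
      rw [hind] at h
      rw [h]
      field_simp
    have hfilter : ((X.filter fun x => x ∈ disc F q y n).card : ℝ) =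
        ((q : ℝ) ^ N + ∑ i : Fin N, if (i : ℕ) < n then
          (digitSign (dig y i) : ℝ) * (q : ℝ) ^ (i : ℕ) else 0) *
            ((q : ℝ) ^ N * ((q : ℝ) ^ n)⁻¹) := by
      rw [← hstrings, ← sum_leading_pow_add_excess hq (dig y), Finset.card_filter]
      push_cast
      simp only [hmem, ← hX]
      exact sum_comp_eq_sum_card_fiber_mul X (fun x => fun i : Fin N => dig x i) fun a =>
        if ∀ i : Fin N, (i : ℕ) < n → a i = dig y i then (1 : ℝ) else 0
    rw [hfilter]
    have hE := abs_sum_digitSign_le hq hn fun i : Fin N => dig y i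
    set E : ℝ := ∑ i : Fin N, if (i : ℕ) < n then
      (digitSign (dig y i) : ℝ) * (q : ℝ) ^ (i : ℕ) else 0
    have hn0 : (0 : ℝ) < (q : ℝ) ^ n := by positivity
    have hdiff : ((q : ℝ) ^ N + E) * ((q : ℝ) ^ N * ((q : ℝ) ^ n)⁻¹) /
        ((q : ℝ) ^ N * (q : ℝ) ^ N) - ((q : ℝ) ^ n)⁻¹ =
          E * ((q : ℝ) ^ n)⁻¹ * ((q : ℝ) ^ N)⁻¹ := by
      field_simp
      ring
    rw [hdiff, abs_mul, abs_mul, abs_of_pos (inv_pos.2 hn0), abs_of_pos (inv_pos.2 hQ)]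
    have hle : |E| * ((q : ℝ) ^ n)⁻¹ ≤ 1 := by
      rw [← div_eq_mul_inv]
      exact (div_le_one hn0).2 hE
    exact mul_le_mul_of_nonneg_right (by linarith) (inv_pos.2 hQ).le
  · have hfilter : ((X.filter fun x => x ∈ disc F q y n).card : ℝ) ≤ 2 * (q : ℝ) ^ N := by
      have hsub : (X.filter fun x => x ∈ disc F q y n) ⊆
          X.filter fun x => (fun i : Fin N => dig x i) = fun i : Fin N => dig y i := by
        refine Finset.monotone_filter_right X fun x _ hx => ?_
        rw [hdig.mem_disc_iff] at hx
        exact funext fun i => hx i (i.2.trans_le hn)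
      have h1 : ((X.filter fun x => x ∈ disc F q y n).card : ℝ) ≤ _ :=
        Nat.cast_le.2 (Finset.card_le_card hsub)
      rw [hX] at h1
      linarith [(abs_le.1 (abs_excess_le hq fun i : Fin N => dig y i)).2]
    have hquot : ((X.filter fun x => x ∈ disc F q y n).card : ℝ) / ((q : ℝ) ^ N * (q : ℝ) ^ N) ≤
        2 * ((q : ℝ) ^ N)⁻¹ := by
      rw [div_le_iff₀ (by positivity)]
      refine hfilter.trans_eq ?_
      field_simp
    have hradius : ((q : ℝ) ^ n)⁻¹ ≤ ((q : ℝ) ^ N)⁻¹ :=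
      inv_anti₀ hQ (pow_le_pow_right₀ (by exact_mod_cast hq.le) hn)
    have hr0 : (0 : ℝ) < ((q : ℝ) ^ n)⁻¹ := by positivity
    have hq0 : (0 : ℝ) ≤ ((X.filter fun x => x ∈ disc F q y n).card : ℝ) /
      ((q : ℝ) ^ N * (q : ℝ) ^ N) := by positivity
    rw [abs_le]
    constructor <;> linarith

theorem geom_sum_inv_le_two {q : ℕ} (hq : 1 < q) (N : ℕ) :
    ∑ j ∈ Finset.range N, ((q : ℝ)⁻¹) ^ j ≤ 2 := by
  have hq2 : (2 : ℝ) ≤ q := by exact_mod_cast hq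
  refine (Finset.sum_le_sum fun j _ => ?_).trans (sum_geometric_two_le N)
  rw [one_div]
  gcongr

theorem no_koksma_inequality_for_taibleson_variation
    (hq : 1 < q)
    (hπ : ‖(π : K)‖ = (q : ℝ)⁻¹)
    (hunif : ∀ x : RoI K, ‖(x : K)‖ < 1 → ‖(x : K)‖ ≤ ‖(π : K)‖)
    (hres : Nat.card (↥(RoI K) ⧸ (Ideal.span {π} : Ideal ↥(RoI K))) = q)
    (μ : Measure (RoI K)) [IsProbabilityMeasure μ] [μ.IsAddHaarMeasure]
    (M : ℕ) (hM : 1 ≤ M) :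
    ∃ (f : RoI K → ℝ) (X : Finset (RoI K)), IsLocallyConstant f ∧ X.Nonempty ∧
      VTaib K q f = 2 ∧
      2 * (M : ℝ) * discrepancy K q μ X ≤
        |(X.card : ℝ)⁻¹ * ∑ x ∈ X, f x - ∫ x, f x ∂μ| := by
  classical
  obtain ⟨dig, hdig⟩ := exists_isDigitSystem hq hπ hres
  obtain ⟨N, hNdef⟩ : ∃ N, N = 4 * M * q := ⟨_, rfl⟩
  have hN : 0 < N := by rw [hNdef]; positivity
  have hQ : (0 : ℝ) < (q : ℝ) ^ N := by positivity
  set S : ℝ := ∑ j ∈ Finset.range N, ((q : ℝ)⁻¹) ^ j with hS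
  have hSpos : 0 < S := Finset.sum_pos (fun _ _ => by positivity) ⟨0, by simpa using hN⟩
  have hS2 : S ≤ 2 := geom_sum_inv_le_two hq N
  obtain ⟨X, hXnat⟩ := hdig.exists_finset_card_fiber hq hπ N fun a =>
    ((q : ℤ) ^ N + excess a).toNat
  have hX : ∀ a, ((X.filter fun x => (fun i : Fin N => dig x i) = a).card : ℝ) =
      (q : ℝ) ^ N + excess a := fun a => by
    have hnonneg : 0 ≤ (q : ℤ) ^ N + excess a := by
      have := (abs_le.1 (abs_excess_le hq a)).1
      have h : (0 : ℝ) ≤ (q : ℝ) ^ N + excess a := by linarith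
      exact_mod_cast h
    rw [hXnat a]
    have h := congrArg (fun z : ℤ => (z : ℝ)) (Int.toNat_of_nonneg hnonneg)
    push_cast at h
    exact h
  have hsum : ∀ G : (Fin N → Fin q) → ℝ, ∑ x ∈ X, G (fun i : Fin N => dig x i) =
      ∑ a, ((q : ℝ) ^ N + excess a) * G a := fun G => by
    rw [sum_comp_eq_sum_card_fiber_mul X (fun x => fun i : Fin N => dig x i) G]
    simp only [hX]
  have hcard : (X.card : ℝ) = (q : ℝ) ^ N * (q : ℝ) ^ N := by
    rw [← sum_pow_add_excess hq]
    simpa using hsum fun _ => 1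
  refine ⟨fun x => S⁻¹ * weightedSign fun i : Fin N => dig x i, X,
    hdig.isLocallyConstant hq fun a => S⁻¹ * weightedSign a, ?_,
    hdig.VTaib_eq_two hq hN μ, ?_⟩
  · rw [← Finset.card_pos]
    have h : (0 : ℝ) < X.card := by rw [hcard]; positivity
    exact_mod_cast h
  · rw [hdig.integral_comp hq μ fun a => S⁻¹ * weightedSign a, ← Finset.mul_sum,
      ← Finset.mul_sum, sum_weightedSign hq, hsum, sum_pow_add_excess_mul_weightedSign hq, hcard,
      mul_zero, mul_zero, sub_zero, abs_of_nonneg (by positivity)]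
    have hpow : (q : ℝ) ^ N = (q : ℝ) ^ (N - 1) * q := (pow_sub_one_mul hN.ne' _).symm
    have hNM : (N : ℝ) = 4 * M * q := by exact_mod_cast hNdef
    calc 2 * (M : ℝ) * discrepancy K q μ X ≤ 2 * (M : ℝ) * (2 * ((q : ℝ) ^ N)⁻¹) := by
          gcongr
          exact hdig.discrepancy_le hq μ hcard hX
      _ = (2 : ℝ)⁻¹ * (8 * M * ((q : ℝ) ^ N)⁻¹) := by ring
      _ ≤ S⁻¹ * (8 * M * ((q : ℝ) ^ N)⁻¹) :=
          mul_le_mul_of_nonneg_right (inv_anti₀ hSpos hS2) (by positivity)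
      _ = ((q : ℝ) ^ N * (q : ℝ) ^ N)⁻¹ * (S⁻¹ * (2 * N * (q : ℝ) ^ (N - 1))) := by
          rw [hNM, hpow]
          have : (q : ℝ) ≠ 0 := by positivity
          field_simp
          ring

end NAKoksma
end
end

section
/- For every continuous function f : O → ℝ, the Taibleson variation is bounded above by the Berkovich-analytic variation: V_Taib(f) ≤ V_Berk(f). -/
open MeasureTheory Set Filter Topology
open scoped ENNReal NNReal

noncomputable section

namespace NAKoksma

variable (K : Type*) [NontriviallyNormedField K] [IsUltrametricDist K]

variable (q : ℕ)

variable [MeasurableSpace K]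

variable (π : RoI K)

section Discs

variable {L : Type*} [NontriviallyNormedField L] [IsUltrametricDist L] {q}

theorem mem_disc_self (a : RoI L) (n : ℕ) : a ∈ disc L q a n := by
  simp only [disc, Set.mem_ofPred_eq, sub_self, norm_zero]
  positivity

theorem disc_antitone (hq : 1 < q) (a : RoI L) : Antitone (disc L q a) := by
  intro m n hmn x hx
  have hq1 : (1 : ℝ) ≤ q := by exact_mod_cast hq.le
  have hexp : -(n : ℤ) ≤ -(m : ℤ) := by lia
  exact le_trans hx (zpow_le_zpow_right₀ hq1 hexp)

theorem disc_eq_of_mem {a b : RoI L} {n : ℕ} (h : b ∈ disc L q a n) :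
    disc L q b n = disc L q a n := by
  have key : ∀ {c d x : RoI L}, d ∈ disc L q c n → x ∈ disc L q d n → x ∈ disc L q c n := by
    intro c d x hd hx
    have := (IsUltrametricDist.norm_add_le_max ((x : L) - d) ((d : L) - c)).trans (max_le hx hd)
    simpa [disc] using this
  have h' : a ∈ disc L q b n := by
    simpa only [disc, Set.mem_ofPred_eq, norm_sub_rev] using h
  exact Set.Subset.antisymm (fun x hx => key h hx) fun x hx => key h' hx

theorem disc_eq_closedBall (a : RoI L) (n : ℕ) :
    disc L q a n = Metric.closedBall a ((q : ℝ) ^ (-(n : ℤ))) := by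
  ext x
  simp [disc, dist_eq_norm]

theorem isOpen_disc (hq : 1 < q) (a : RoI L) (n : ℕ) : IsOpen (disc L q a n) := by
  have : (disc L q a n) = (Subtype.val : RoI L → L) ⁻¹'
      Metric.closedBall (a : L) ((q : ℝ) ^ (-(n : ℤ))) := by
    ext x
    simp [disc, dist_eq_norm]
  rw [this]
  refine (IsUltrametricDist.isOpen_closedBall _ ?_).preimage continuous_subtype_val
  have : (0 : ℝ) < q := by exact_mod_cast hq.pos
  positivity

theorem tendsto_disc_radius (hq : 1 < q) :
    Tendsto (fun n : ℕ => (q : ℝ) ^ (-(n : ℤ))) atTop (𝓝 0) := by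
  have h : (1 : ℝ) < q := by exact_mod_cast hq
  simpa [zpow_neg, inv_pow] using
    tendsto_pow_atTop_nhds_zero_of_lt_one (inv_nonneg.2 (zero_le_one.trans h.le))
      (inv_lt_one_of_one_lt₀ h)

/-- Every neighbourhood of a point contains all sufficiently small discs around it. -/
theorem eventually_disc_subset (hq : 1 < q) {a : RoI L} {s : Set (RoI L)} (hs : s ∈ 𝓝 a) :
    ∀ᶠ n in atTop, disc L q a n ⊆ s := by
  obtain ⟨ε, hε, hsub⟩ := Metric.nhds_basis_closedBall.mem_iff.1 hs
  filter_upwards [(tendsto_disc_radius hq).eventually_le_const hε] with n hn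
  rw [disc_eq_closedBall]
  exact (Metric.closedBall_subset_closedBall hn).trans hsub

/-- The additive subgroup `π ^ n O` of the ring of integers. -/
def piPow (π : RoI L) (n : ℕ) : AddSubgroup (RoI L) :=
  (⊤ : AddSubgroup (RoI L)).map (AddMonoidHom.mulLeft (π ^ n))

theorem piPow_succ (π : RoI L) (n : ℕ) :
    piPow π (n + 1) = (piPow π 1).map (AddMonoidHom.mulLeft (π ^ n)) := by
  rw [piPow, piPow, AddSubgroup.map_map]
  congr 1
  ext x
  simp [pow_succ, mul_assoc]

theorem coe_piPow {π : RoI L} (hq : 1 < q) (hπ : ‖(π : L)‖ = (q : ℝ)⁻¹) (n : ℕ) :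
    (piPow π n : Set (RoI L)) = disc L q 0 n := by
  have hq0 : (q : ℝ) ≠ 0 := by exact_mod_cast hq.ne_bot
  have hπ0 : (π : L) ≠ 0 := norm_ne_zero_iff.1 (hπ ▸ inv_ne_zero hq0)
  ext x
  constructor
  · rintro ⟨y, -, rfl⟩
    have hy : ‖(y : L)‖ ≤ 1 := y.2
    have : ‖(π : L)‖ ^ n * ‖(y : L)‖ ≤ ‖(π : L)‖ ^ n := mul_le_of_le_one_right (by positivity) hy
    simpa [disc, hπ] using this
  · intro hx
    have hx' : ‖(x : L)‖ ≤ ‖(π : L)‖ ^ n := by simpa [disc, hπ] using hx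
    refine ⟨⟨(x : L) / (π : L) ^ n, ?_⟩, trivial, ?_⟩
    · change ‖(x : L) / (π : L) ^ n‖ ≤ 1
      rw [norm_div, norm_pow]
      exact div_le_one_of_le₀ hx' (by positivity)
    · apply Subtype.ext
      simp [mul_div_cancel₀, hπ0]

theorem index_piPow {π : RoI L} (hπ0 : π ≠ 0)
    (hres : Nat.card (↥(RoI L) ⧸ (Ideal.span {π} : Ideal ↥(RoI L))) = q) (n : ℕ) :
    (piPow π n).index = q ^ n := by
  have h1 : (piPow π 1).index = q := by
    have : piPow π 1 = (Ideal.span {π} : Ideal (RoI L)).toAddSubgroup := by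
      ext x
      simp [piPow, Ideal.mem_span_singleton, dvd_def, eq_comm]
    rw [this]
    exact hres
  induction n with
  | zero =>
    have : piPow π 0 = ⊤ := by
      ext x
      simp [piPow]
    simp [this]
  | succ n ih =>
    have hle : piPow π (n + 1) ≤ piPow π n := by
      rw [piPow_succ]
      exact AddSubgroup.map_mono le_top
    have hinj : Function.Injective (AddMonoidHom.mulLeft (π ^ n)) :=
      mul_right_injective₀ (pow_ne_zero n hπ0)
    rw [← AddSubgroup.relIndex_mul_index hle, ih, piPow_succ, piPow.eq_def π n,
      AddSubgroup.relIndex_map_map_of_injective _ _ hinj, AddSubgroup.relIndex_top_right, h1,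
      pow_succ']

variable [MeasurableSpace L]

/-- A disc of radius `q ^ (-n)` has Haar measure `q ^ (-n)`. -/
theorem measure_disc [BorelSpace L] {π : RoI L} (hq : 1 < q) (hπ : ‖(π : L)‖ = (q : ℝ)⁻¹)
    (hres : Nat.card (↥(RoI L) ⧸ (Ideal.span {π} : Ideal ↥(RoI L))) = q)
    (μ : Measure (RoI L)) [IsProbabilityMeasure μ] [μ.IsAddHaarMeasure] (a : RoI L) (n : ℕ) :
    μ (disc L q a n) = ((q : ℝ≥0∞) ^ n)⁻¹ := by
  have hq0 : (q : ℝ) ≠ 0 := by exact_mod_cast hq.ne_bot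
  have hπ0 : π ≠ 0 := by
    rintro rfl
    simp [hq0, eq_comm] at hπ
  have htrans : disc L q a n = (fun x => -a + x) ⁻¹' disc L q 0 n := by
    ext x
    simp [disc, sub_eq_neg_add]
  rw [htrans, measure_preimage_add, ← coe_piPow hq hπ]
  have hidx := index_piPow hπ0 hres n
  have : (piPow π n).FiniteIndex := ⟨by rw [hidx]; exact pow_ne_zero _ hq.ne_bot⟩
  have hmeas : MeasurableSet (piPow π n : Set (RoI L)) := by
    rw [coe_piPow hq hπ]
    exact (isOpen_disc hq 0 n).measurableSet
  have := (piPow π n).index_mul_measure hmeas μ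
  rw [hidx, measure_univ, mul_comm] at this
  exact_mod_cast ENNReal.eq_inv_of_mul_eq_one_left this

/-- Averages of a continuous function over shrinking discs converge to its value. -/
theorem tendsto_average_disc [BorelSpace L] (hq : 1 < q) (μ : Measure (RoI L))
    [IsFiniteMeasure μ] [μ.IsOpenPosMeasure] {f : RoI L → ℝ} (hf : Continuous f) (a : RoI L) :
    Tendsto (fun n => ⨍ x in disc L q a n, f x ∂μ) atTop (𝓝 (f a)) := by
  rw [Metric.nhds_basis_closedBall.tendsto_right_iff]
  intro ε hε
  filter_upwards [eventually_disc_subset hq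
    (hf.continuousAt.preimage_mem_nhds (Metric.closedBall_mem_nhds (f a) hε))] with n hn
  have hmeas : MeasurableSet (disc L q a n) := (isOpen_disc hq a n).measurableSet
  have hae : ∀ᵐ x ∂μ.restrict (disc L q a n), f x ∈ Metric.closedBall (f a) ε :=
    (ae_restrict_iff' hmeas).2 (.of_forall fun x hx => hn hx)
  refine (convex_closedBall _ _).set_average_mem Metric.isClosed_closedBall
    ((isOpen_disc hq a n).measure_pos μ ⟨a, mem_disc_self a n⟩).ne' (measure_ne_top _ _) hae ?_
  refine Integrable.of_bound hf.aestronglyMeasurable (‖f a‖ + ε) ?_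
  filter_upwards [hae] with x hx
  exact norm_le_norm_add_const_of_dist_le hx

variable (q) in
/-- The pairs `(E, E')` of discs with `E' ≺ E` and `E ⊆ D`. -/
def edgesBelow (μ : Measure (RoI L)) (D : Set (RoI L)) : Set (Set (RoI L) × Set (RoI L)) :=
  {p | (IsDisc L q p.1 ∧ p.1 ⊆ D) ∧ IsDisc L q p.2 ∧ p.2 ⊆ p.1 ∧ μ p.2 = μ p.1 / (q : ℝ≥0∞)}

/-- The contribution `|f(E') - f(E)|` of a pair `(E, E')` to the Berkovich-analytic variation. -/
def edgeJump (μ : Measure (RoI L)) (f : RoI L → ℝ) (p : Set (RoI L) × Set (RoI L)) : ℝ≥0∞ :=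
  ENNReal.ofReal |(⨍ x in p.2, f x ∂μ) - ⨍ x in p.1, f x ∂μ|

theorem sum_edgesBelow_le_VBerk (μ : Measure (RoI L)) (f : RoI L → ℝ)
    {P : Finset (Set (RoI L))} (hP : (P : Set (Set (RoI L))).PairwiseDisjoint id) :
    ∑ D ∈ P, ∑' p : edgesBelow q μ D, edgeJump μ f p ≤ VBerk L q μ f := by
  have hdisj : (P : Set (Set (RoI L))).PairwiseDisjoint (edgesBelow q μ) := by
    intro D hD D' hD' hne
    refine Set.disjoint_left.2 fun p hp hp' => ?_
    obtain ⟨⟨⟨a, n, ha⟩, hsub⟩, -⟩ := hp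
    have hmem : a ∈ p.1 := ha ▸ mem_disc_self a n
    exact Set.disjoint_left.1 (hP hD hD' hne) (hsub hmem) (hp'.1.2 hmem)
  rw [← Finset.tsum_subtype P fun D => ∑' p : edgesBelow q μ D, edgeJump μ f p]
  refine (ENNReal.tsum_biUnion' hdisj).symm.le.trans ?_
  refine (ENNReal.tsum_mono_subtype _
    (t := edgesBelow q μ Set.univ) ?_).trans ?_
  · exact Set.iUnion₂_subset fun D _ p hp => ⟨⟨hp.1.1, Set.subset_univ _⟩, hp.2⟩
  · rw [VBerk, ← ENNReal.tsum_sigma]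
    let i : edgesBelow q μ Set.univ → Σ D : {D : Set (RoI L) // IsDisc L q D},
        {D' : Set (RoI L) // IsDisc L q D' ∧ D' ⊆ D.1 ∧ μ D' = μ D.1 / (q : ℝ≥0∞)} :=
      fun p => ⟨⟨p.1.1, p.2.1.1⟩, ⟨p.1.2, p.2.2⟩⟩
    have hi : Function.Injective i :=
      Function.LeftInverse.injective
        (g := fun s => ⟨(s.1.1, s.2.1), ⟨s.1.2, Set.subset_univ _⟩, s.2.2⟩) fun _ => rfl
    exact ENNReal.tsum_comp_le_tsum_of_injective hi fun s =>
      ENNReal.ofReal |(⨍ x in s.2.1, f x ∂μ) - ⨍ x in s.1.1, f x ∂μ|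

/-- The value of `f` at `a` differs from its average over a disc around `a` by at most the sum of
the jumps of `f` along the chain of smaller discs around `a`. -/
theorem edist_average_disc_le [BorelSpace L] (hq : 1 < q) (μ : Measure (RoI L))
    [IsFiniteMeasure μ] [μ.IsOpenPosMeasure] {f : RoI L → ℝ} (hf : Continuous f) (a : RoI L)
    (N : ℕ) :
    edist (⨍ x in disc L q a N, f x ∂μ) (f a) ≤
      ∑' k, edgeJump μ f (disc L q a (N + k), disc L q a (N + k + 1)) := by
  have hlim : Tendsto (fun k => ⨍ x in disc L q a (N + k), f x ∂μ) atTop (𝓝 (f a)) :=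
    (tendsto_average_disc hq μ hf a).comp (tendsto_add_atTop_nat N |>.congr fun k => add_comm k N)
  refine edist_le_tsum_of_edist_le_of_tendsto₀ _ (fun k => ?_) hlim
  rw [edist_comm, edist_dist, Real.dist_eq, edgeJump, add_assoc]

theorem ofReal_sub_le_tsum_edgesBelow [BorelSpace L] {π : RoI L} (hq : 1 < q)
    (hπ : ‖(π : L)‖ = (q : ℝ)⁻¹)
    (hres : Nat.card (↥(RoI L) ⧸ (Ideal.span {π} : Ideal ↥(RoI L))) = q)
    (μ : Measure (RoI L)) [IsProbabilityMeasure μ] [μ.IsAddHaarMeasure]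
    {f : RoI L → ℝ} (hf : Continuous f) {D : Set (RoI L)} (hD : IsDisc L q D)
    {x y : RoI L} (hx : x ∈ D) (hy : y ∈ D) :
    ENNReal.ofReal (f x - f y) ≤ ∑' p : edgesBelow q μ D, edgeJump μ f p := by
  obtain rfl | hxy := eq_or_ne x y
  · simp
  obtain ⟨a, n, rfl⟩ := hD
  rw [← disc_eq_of_mem hx] at hy ⊢
  have hq0 : (q : ℝ≥0∞) ≠ 0 := by exact_mod_cast hq.ne_bot
  have hμ := measure_disc hq hπ hres μ
  -- `N` is the last level at which the discs around `x` and `y` coincide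
  obtain ⟨N, hnN, hyN, hyN'⟩ :
      ∃ N, n ≤ N ∧ y ∈ disc L q x N ∧ y ∉ disc L q x (N + 1) := by
    by_contra! hcon
    have hall : ∀ m ≥ n, y ∈ disc L q x m := fun m hm =>
      Nat.le_induction hy (fun k hk ih => hcon k hk ih) m hm
    obtain ⟨m, hm, hnm⟩ :=
      ((eventually_disc_subset hq (isOpen_ne.mem_nhds hxy)).and (eventually_ge_atTop n)).exists
    exact hm (hall m hnm) rfl
  have hNxy : disc L q y N = disc L q x N := disc_eq_of_mem hyN
  have hlevel : ∀ {a b : RoI L} {k l : ℕ}, disc L q a k = disc L q b l → k = l := by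
    intro a b k l h
    have := congrArg μ h
    rw [hμ, hμ, inv_inj] at this
    exact Nat.pow_right_injective hq (by exact_mod_cast this)
  let z : Bool → RoI L := fun b => cond b x y
  have hz : ∀ b, disc L q (z b) N = disc L q x N := by
    rintro (_ | _)
    exacts [hNxy, rfl]
  let i : Bool × ℕ → edgesBelow q μ (disc L q x n) := fun s =>
    ⟨(disc L q (z s.1) (N + s.2), disc L q (z s.1) (N + s.2 + 1)),
      ⟨⟨⟨_, _, rfl⟩, (disc_antitone hq _ (Nat.le_add_right N s.2)).trans
          ((hz s.1).subset.trans (disc_antitone hq x hnN))⟩,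
        ⟨_, _, rfl⟩, disc_antitone hq _ (Nat.le_succ _), by
          rw [hμ, hμ, pow_succ, ENNReal.mul_inv (.inr (ENNReal.natCast_ne_top q)) (.inr hq0),
            div_eq_mul_inv]⟩⟩
  have hne : ∀ k, disc L q x (N + k + 1) ≠ disc L q y (N + k + 1) := fun k h =>
    hyN' <| disc_antitone hq x (by lia : N + 1 ≤ N + k + 1) (h ▸ mem_disc_self y _)
  have hi : Function.Injective i := by
    rintro ⟨b, k⟩ ⟨c, l⟩ h
    obtain ⟨h₁, h₂⟩ := Prod.ext_iff.1 (congrArg Subtype.val h)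
    obtain rfl : k = l := Nat.add_left_cancel (hlevel h₁)
    cases b <;> cases c
    exacts [rfl, absurd h₂.symm (hne k), absurd h₂ (hne k), rfl]
  have hsum := ENNReal.tsum_comp_le_tsum_of_injective hi fun p => edgeJump μ f p
  rw [ENNReal.tsum_prod', tsum_bool] at hsum
  calc ENNReal.ofReal (f x - f y) ≤ edist (f x) (f y) := by
        rw [edist_dist, Real.dist_eq]
        exact ENNReal.ofReal_le_ofReal (le_abs_self _)
    _ ≤ edist (⨍ t in disc L q y N, f t ∂μ) (f y) + edist (⨍ t in disc L q x N, f t ∂μ) (f x) := by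
        rw [hNxy, add_comm]
        exact edist_triangle_left _ _ _
    _ ≤ _ := add_le_add (edist_average_disc_le hq μ hf y N) (edist_average_disc_le hq μ hf x N)
    _ ≤ _ := hsum

end Discs

variable [LocallyCompactSpace K] [BorelSpace K]

theorem VTaib_le_VBerk
    (hq : 1 < q)
    (hπ : ‖(π : K)‖ = (q : ℝ)⁻¹)
    (hunif : ∀ x : RoI K, ‖(x : K)‖ < 1 → ‖(x : K)‖ ≤ ‖(π : K)‖)
    (hres : Nat.card (↥(RoI K) ⧸ (Ideal.span {π} : Ideal ↥(RoI K))) = q)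
    (μ : Measure (RoI K)) [IsProbabilityMeasure μ] [μ.IsAddHaarMeasure]
    (f : RoI K → ℝ) (hf : Continuous f) :
    VTaib K q f ≤ VBerk K q μ f := by
  refine iSup_le fun P => le_trans (Finset.sum_le_sum fun D hD => ?_)
    (sum_edgesBelow_le_VBerk μ f P.2.2.1)
  exact iSup₂_le fun x hx => iSup₂_le fun y hy =>
    ofReal_sub_le_tsum_edgesBelow hq hπ hres μ hf (P.2.1 D hD) hx hy

end NAKoksma
end
end

section
/- If f : O → ℝ is Haar-integrable and has finite Fourier-analytic variation V_Fourier(f) < +∞, then there exists a unique continuous function g : O → ℝ such that f(x) = g(x) for Haar-almost all x ∈ O. -/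
open MeasureTheory Set Filter Topology
open scoped ENNReal NNReal

noncomputable section

namespace NAKoksma

variable (K : Type*) [NontriviallyNormedField K] [IsUltrametricDist K]

variable (q : ℕ)

variable [MeasurableSpace K]

variable (π : RoI K)

theorem summable_subtype_of_summable_subtype_ne {ι : Type*} {p : ι → Prop} {a : ι → ℝ} {i : ι}
    (h : Summable fun j : {j // p j ∧ j ≠ i} => a j) : Summable fun j : {j // p j} => a j := by
  have hone : Summable (a ∘ ((↑) : ({i} : Set ι) → ι)) := (hasSum_fintype _).summable
  have hdisj : Disjoint {j | p j ∧ j ≠ i} {i} := Set.disjoint_singleton_right.2 fun h => h.2 rfl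
  have hunion : Summable (a ∘ ((↑) : ↥({j | p j ∧ j ≠ i} ∪ {i}) → ι)) :=
    (HasSum.add_disjoint (f := a) hdisj h.hasSum hone.hasSum).summable
  have hsub : {j | p j} ⊆ {j | p j ∧ j ≠ i} ∪ {i} := fun j hj => by
    by_cases hji : j = i
    · exact Or.inr hji
    · exact Or.inl ⟨hj, hji⟩
  exact hunion.comp_injective (Set.inclusion_injective hsub)

section CompactGroup

variable {G : Type*} [AddCommGroup G] [TopologicalSpace G]

/-- The cosets of open subgroups of an additive topological group. -/
def openCosets (G : Type*) [AddCommGroup G] [TopologicalSpace G] : Set (Set G) :=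
  {s | ∃ (U : OpenAddSubgroup G) (a : G), s = {x | x - a ∈ U}}

theorem isPiSystem_openCosets : IsPiSystem (openCosets G) := by
  rintro _ ⟨U, a, rfl⟩ _ ⟨V, b, rfl⟩ ⟨z, hza, hzb⟩
  refine ⟨U ⊓ V, z, Set.ext fun x => ?_⟩
  have coset_eq : ∀ (W : OpenAddSubgroup G) (c : G), z - c ∈ W → (x - c ∈ W ↔ x - z ∈ W) := by
    intro W c hzc
    rw [← sub_add_sub_cancel x z c]
    exact add_mem_cancel_right hzc
  simp only [mem_inter_iff, mem_ofPred_eq, OpenAddSubgroup.mem_inf]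
  rw [coset_eq U a hza, coset_eq V b hzb]

theorem isTopologicalBasis_openCosets [NonarchimedeanAddGroup G] :
    TopologicalSpace.IsTopologicalBasis (openCosets G) := by
  refine TopologicalSpace.isTopologicalBasis_of_isOpen_of_nhds ?_ ?_
  · rintro _ ⟨U, a, rfl⟩
    exact U.isOpen.preimage (continuous_id.sub continuous_const)
  · intro a u ha hu
    have hnhds : (fun y => y + a) ⁻¹' u ∈ 𝓝 (0 : G) :=
      (hu.preimage (continuous_id.add continuous_const)).mem_nhds (by simpa using ha)
    obtain ⟨V, hV⟩ := NonarchimedeanAddGroup.is_nonarchimedean _ hnhds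
    refine ⟨_, ⟨V, a, rfl⟩, ?_, fun x hx => ?_⟩
    · simp
    · simpa using hV hx

/-- The indicator function of a coset of an open subgroup of a compact abelian group is a
linear combination of continuous characters. -/
theorem exists_indicator_coset_eq_sum_addChar [IsTopologicalAddGroup G] [CompactSpace G]
    (U : OpenAddSubgroup G) (a : G) :
    ∃ (s : Finset (AddChar G Circle)) (c : AddChar G Circle → ℂ),
      (∀ γ ∈ s, Continuous γ) ∧
        ∀ x, {x | x - a ∈ U}.indicator (1 : G → ℂ) x = ∑ γ ∈ s, c γ * (γ x : ℂ) := by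
  classical
  let Q := G ⧸ U.toAddSubgroup
  have : Finite Q := U.toAddSubgroup.quotient_finite_of_isOpen U.isOpen
  have : Fintype Q := Fintype.ofFinite Q
  have : DiscreteTopology Q := QuotientAddGroup.discreteTopology U.isOpen
  let p : G →+ Q := QuotientAddGroup.mk' U.toAddSubgroup
  have hp : Function.Surjective p := QuotientAddGroup.mk'_surjective _
  let L : AddChar Q ℂ → AddChar G Circle :=
    fun ψ => (AddChar.circleEquivComplex.symm ψ).compAddMonoidHom p
  have hL : ∀ ψ x, (L ψ x : ℂ) = ψ (p x) := by
    intro ψ x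
    exact congrArg (fun χ : AddChar Q ℂ => χ (p x))
      (AddChar.circleEquivComplex.apply_symm_apply ψ)
  have hLinj : Function.Injective L := by
    intro ψ ψ' h
    ext y
    obtain ⟨x, rfl⟩ := hp y
    rw [← hL, ← hL, h]
  refine ⟨Finset.univ.image L, fun γ => (Fintype.card Q : ℂ)⁻¹ * (γ (-a) : ℂ), ?_, fun x => ?_⟩
  · intro γ hγ
    obtain ⟨ψ, -, rfl⟩ := Finset.mem_image.1 hγ
    have : Continuous p := continuous_quotient_mk'
    exact (continuous_of_discreteTopology (f := AddChar.circleEquivComplex.symm ψ)).comp this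
  · rw [Finset.sum_image hLinj.injOn]
    have hmem : p (x - a) = 0 ↔ x - a ∈ U := QuotientAddGroup.eq_zero_iff _
    have hcard : (Fintype.card Q : ℂ) ≠ 0 := Nat.cast_ne_zero.2 Fintype.card_ne_zero
    calc {x | x - a ∈ U}.indicator (1 : G → ℂ) x
        = (Fintype.card Q : ℂ)⁻¹ * ∑ ψ : AddChar Q ℂ, ψ (p (x - a)) := by
          rw [AddChar.sum_apply_eq_ite, Set.indicator_apply]
          simp only [hmem, mem_ofPred_eq, Pi.one_apply]
          split_ifs <;> simp [hcard]
      _ = _ := by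
          rw [Finset.mul_sum]
          refine Finset.sum_congr rfl fun ψ _ => ?_
          beta_reduce
          rw [hL, hL, sub_eq_add_neg, map_add, AddChar.map_add_eq_mul]
          ring

variable [MeasurableSpace G] [BorelSpace G] {μ : Measure G}

/-- An integrable function on a nonarchimedean compact abelian group is determined almost
everywhere by its Fourier coefficients. -/
theorem ae_eq_zero_of_forall_integral_mul_addChar_eq_zero [NonarchimedeanAddGroup G]
    [CompactSpace G] [SecondCountableTopology G] {h : G → ℂ} (hh : Integrable h μ)
    (hzero : ∀ γ : AddChar G Circle, Continuous γ → ∫ x, h x * (γ x : ℂ) ∂μ = 0) :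
    h =ᵐ[μ] 0 := by
  classical
  have hcoset : ∀ s ∈ openCosets G, ∫ x in s, h x ∂μ = 0 := by
    rintro _ ⟨U, a, rfl⟩
    obtain ⟨t, c, ht, hind⟩ := exists_indicator_coset_eq_sum_addChar U a
    have hmeas : MeasurableSet {x | x - a ∈ U} :=
      (U.isOpen.preimage (continuous_id.sub continuous_const)).measurableSet
    rw [← integral_indicator hmeas]
    calc ∫ x, {x | x - a ∈ U}.indicator h x ∂μ
        = ∫ x, ∑ γ ∈ t, c γ * (h x * (γ x : ℂ)) ∂μ := by
          refine integral_congr_ae (Eventually.of_forall fun x => ?_)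
          calc {x | x - a ∈ U}.indicator h x
              = h x * {x | x - a ∈ U}.indicator (1 : G → ℂ) x := by
                simp [Set.indicator_apply]
            _ = _ := by
                rw [hind, Finset.mul_sum]
                exact Finset.sum_congr rfl fun γ _ => by ring
      _ = ∑ γ ∈ t, c γ * ∫ x, h x * (γ x : ℂ) ∂μ := by
          rw [integral_finsetSum]
          · simp_rw [integral_const_mul]
          · intro γ hγ
            refine (hh.mul_bdd (c := 1) ?_ (Eventually.of_forall fun x => ?_)).const_mul _
            · exact (continuous_induced_dom.comp (ht γ hγ)).aestronglyMeasurable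
            · exact (Circle.norm_coe _).le
      _ = 0 := Finset.sum_eq_zero fun γ hγ => by rw [hzero γ (ht γ hγ), mul_zero]
  have huniv : ∫ x, h x ∂μ = 0 := by
    simpa using hzero 1 (continuous_const (y := (1 : Circle)))
  suffices hall : ∀ s, MeasurableSet s → ∫ x in s, h x ∂μ = 0 from
    hh.ae_eq_zero_of_forall_setIntegral_eq_zero fun s hs _ => hall s hs
  intro s hs
  have hgen : ‹MeasurableSpace G› = MeasurableSpace.generateFrom (openCosets G) :=
    BorelSpace.measurable_eq.trans isTopologicalBasis_openCosets.borel_eq_generateFrom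
  induction s, hs using MeasurableSpace.induction_on_inter hgen isPiSystem_openCosets with
  | empty => simp
  | basic t ht => exact hcoset t ht
  | compl t ht iht => rw [setIntegral_compl ht hh, huniv, iht, sub_zero]
  | iUnion f hdisj hmeas ihf =>
    rw [integral_iUnion hmeas hdisj hh.integrableOn]
    simp [ihf]

theorem integral_addChar_eq_zero [IsTopologicalAddGroup G] [μ.IsAddLeftInvariant]
    {γ : AddChar G Circle} (hγ : γ ≠ 1) : ∫ x, (γ x : ℂ) ∂μ = 0 := by
  obtain ⟨a, ha⟩ := AddChar.ne_one_iff.1 hγ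
  have hinv : (γ a : ℂ) * ∫ x, (γ x : ℂ) ∂μ = ∫ x, (γ x : ℂ) ∂μ := by
    rw [← integral_const_mul, ← integral_add_left_eq_self (fun x => (γ x : ℂ)) a]
    simp [AddChar.map_add_eq_mul]
  by_contra hne
  exact ha (Circle.coe_eq_one.1 (mul_eq_right₀ hne |>.1 hinv))

theorem integral_addChar_mul_addChar [IsTopologicalAddGroup G] [IsProbabilityMeasure μ]
    [μ.IsAddLeftInvariant] [DecidableEq (AddChar G Circle)] (γ χ : AddChar G Circle) :
    ∫ x, (γ x : ℂ) * (χ x : ℂ) ∂μ = if γ = χ⁻¹ then 1 else 0 := by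
  have hmul : ∀ x, (γ x : ℂ) * (χ x : ℂ) = ((γ * χ) x : ℂ) := by simp [AddChar.mul_apply]
  simp_rw [hmul]
  split_ifs with h
  · simp [h]
  · exact integral_addChar_eq_zero (fun h' => h (eq_inv_of_mul_eq_one_left h'))

/-- An integrable function with absolutely summable Fourier coefficients is almost everywhere
equal to the sum of its Fourier series; in particular to a continuous function. -/
theorem exists_continuous_ae_eq_of_summable_fourier [NonarchimedeanAddGroup G]
    [CompactSpace G] [SecondCountableTopology G] [IsProbabilityMeasure μ]
    [μ.IsAddLeftInvariant] {f : G → ℂ} (hf : Integrable f μ)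
    (hsum : Summable fun γ : {γ : AddChar G Circle // Continuous γ} =>
      ‖∫ x, f x * (starRingEnd ℂ) (γ.1 x : ℂ) ∂μ‖) :
    ∃ g : G → ℂ, Continuous g ∧ f =ᵐ[μ] g := by
  classical
  let c : {γ : AddChar G Circle // Continuous γ} → ℂ :=
    fun γ => ∫ x, f x * (starRingEnd ℂ) (γ.1 x : ℂ) ∂μ
  let F : {γ : AddChar G Circle // Continuous γ} → C(G, ℂ) :=
    fun γ => c γ • ⟨fun x => (γ.1 x : ℂ), continuous_induced_dom.comp γ.2⟩
  have hF : Summable F := by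
    refine Summable.of_norm_bounded hsum fun γ => ?_
    exact (ContinuousMap.norm_le _ (norm_nonneg _)).2 fun x => by simp [F, c, Circle.norm_coe]
  have hint : ∀ φ : C(G, ℂ), Integrable φ μ := fun φ =>
    φ.continuous.integrable_of_hasCompactSupport (HasCompactSupport.of_compactSpace φ)
  have hintmul : ∀ {h : G → ℂ}, Integrable h μ → ∀ χ : AddChar G Circle, Continuous χ →
      Integrable (fun x => h x * (χ x : ℂ)) μ := fun hh χ hχ =>
    hh.mul_bdd (c := 1) (continuous_induced_dom.comp hχ).aestronglyMeasurable
      (Eventually.of_forall fun x => (Circle.norm_coe _).le)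
  refine ⟨⇑(∑' γ, F γ), (∑' γ, F γ).continuous, ?_⟩
  have hdiff : f - ⇑(∑' γ, F γ) =ᵐ[μ] 0 := by
    refine ae_eq_zero_of_forall_integral_mul_addChar_eq_zero (hf.sub (hint _)) fun χ hχ => ?_
    let pairing : C(G, ℂ) →L[ℂ] ℂ := LinearMap.mkContinuous
      { toFun := fun φ => ∫ x, φ x * (χ x : ℂ) ∂μ
        map_add' := fun φ ψ => by
          simp only [ContinuousMap.add_apply, add_mul]
          exact integral_add (hintmul (hint φ) χ hχ) (hintmul (hint ψ) χ hχ)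
        map_smul' := fun z φ => by
          simp [mul_assoc, integral_const_mul] } 1 fun φ => by
        refine (norm_integral_le_of_norm_le_const (C := ‖φ‖)
          (Eventually.of_forall fun x => ?_)).trans (by simp)
        simpa [Circle.norm_coe] using φ.norm_coe_le_norm x
    have hpair : ∀ γ, pairing (F γ) = if γ.1 = χ⁻¹ then c γ else 0 := by
      intro γ
      change ∫ x, c γ * (γ.1 x : ℂ) * (χ x : ℂ) ∂μ = _
      simp_rw [mul_assoc, integral_const_mul, integral_addChar_mul_addChar]
      simp
    have hχinv : Continuous (χ⁻¹ : AddChar G Circle) := by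
      change Continuous fun x => χ (-x)
      exact hχ.comp continuous_neg
    have hseries : pairing (∑' γ, F γ) = ∫ x, f x * (χ x : ℂ) ∂μ := by
      rw [pairing.map_tsum hF, tsum_eq_single ⟨χ⁻¹, hχinv⟩, hpair, if_pos rfl]
      · simp [c, AddChar.map_neg_eq_inv, ← Circle.coe_inv_eq_conj]
      · intro γ hγ
        rw [hpair, if_neg fun h => hγ (Subtype.ext h)]
    simp only [Pi.sub_apply, sub_mul]
    rw [integral_sub (hintmul hf χ hχ) (hintmul (hint _) χ hχ), ← hseries]
    exact sub_self _
  filter_upwards [hdiff] with x hx using sub_eq_zero.1 hx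

end CompactGroup

variable [LocallyCompactSpace K] [BorelSpace K]

theorem VFourier_finite_ae_eq_continuous
    (hq : 1 < q)
    (hπ : ‖(π : K)‖ = (q : ℝ)⁻¹)
    (hunif : ∀ x : RoI K, ‖(x : K)‖ < 1 → ‖(x : K)‖ ≤ ‖(π : K)‖)
    (hres : Nat.card (↥(RoI K) ⧸ (Ideal.span {π} : Ideal ↥(RoI K))) = q)
    (μ : Measure (RoI K)) [IsProbabilityMeasure μ] [μ.IsAddHaarMeasure]
    (f : RoI K → ℝ) (hf : Integrable f μ) (hV : VFourier K q π μ f < ⊤) :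
    ∃! g : RoI K → ℝ, Continuous g ∧ f =ᵐ[μ] g := by
  have : ProperSpace K := ProperSpace.of_locallyCompactSpace K
  have : CompactSpace (RoI K) := by
    refine isCompact_iff_compactSpace.1 ?_
    convert isCompact_closedBall (0 : K) 1 using 1
    ext x
    simp [RoI]
  have hsum : Summable fun γ : {γ : AddChar (RoI K) Circle // Continuous ⇑γ ∧ γ ≠ 1} =>
      ‖fourierCoeff K μ (fun x => (f x : ℂ)) γ.1‖ := by
    rw [VFourier] at hV
    have hweighted := ENNReal.summable_toReal hV.ne
    refine Summable.of_nonneg_of_le (fun γ => norm_nonneg _) (fun γ => ?_) hweighted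
    rw [ENNReal.toReal_ofReal (by positivity)]
    exact le_mul_of_one_le_left (norm_nonneg _) (one_le_pow₀ (by exact_mod_cast hq.le))
  have hsum' := summable_subtype_of_summable_subtype_ne
    (a := fun γ => ‖fourierCoeff K μ (fun x => (f x : ℂ)) γ‖) hsum
  obtain ⟨g, hg, hfg⟩ := exists_continuous_ae_eq_of_summable_fourier hf.ofReal hsum'
  have hre : f =ᵐ[μ] fun x => (g x).re := by
    filter_upwards [hfg] with x hx
    rw [← hx]
    exact (Complex.ofReal_re _).symm
  refine ⟨fun x => (g x).re, ⟨Complex.continuous_re.comp hg, hre⟩, ?_⟩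
  rintro g' ⟨hg', hfg'⟩
  exact (hg'.ae_eq_iff_eq μ (Complex.continuous_re.comp hg)).1 (hfg'.symm.trans hre)

end NAKoksma
end
end

section
/- For every continuous function f : O → ℝ, the Taibleson variation satisfies V_Taib(f) ≤ (2/q)·V_Fourier(f). -/
open MeasureTheory Set Filter Topology
open scoped ENNReal NNReal

noncomputable section

namespace AddSubgroup

variable {A : Type*} [AddCommGroup A] [TopologicalSpace A] [IsTopologicalAddGroup A]
  [CompactSpace A] [MeasurableSpace A] [BorelSpace A]

/-- The partial Fourier sum of a continuous function over the characters that are trivial on an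
open subgroup `H` is within `ε` of the function at `x` if the function varies by at most `ε` on the
coset of `x`. -/
lemma norm_sum_integral_mul_addChar_sub_le (μ : Measure A) [IsProbabilityMeasure μ]
    [μ.IsAddLeftInvariant] (H : AddSubgroup A) (hH : IsOpen (H : Set A)) [Finite (A ⧸ H)]
    {f : A → ℂ} (hf : Continuous f) {ε : ℝ} {x : A} (hε : ∀ y, y - x ∈ H → ‖f y - f x‖ ≤ ε) :
    ‖∑ ψ : AddChar (A ⧸ H) ℂ,
      (∫ y, f y * (starRingEnd ℂ) (ψ (y : A ⧸ H)) ∂μ) * ψ (x : A ⧸ H) - f x‖ ≤ ε := by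
  classical
  have : Fintype (A ⧸ H) := Fintype.ofFinite _
  have : H.FiniteIndex := finiteIndex_of_finite_quotient
  have : DiscreteTopology (A ⧸ H) := QuotientAddGroup.discreteTopology hH
  have hmk : Continuous fun y : A => (y : A ⧸ H) := continuous_quotient_mk'
  have hint : ∀ g : A → ℂ, Continuous g → Integrable g μ := fun g hg =>
    hg.integrable_of_hasCompactSupport (HasCompactSupport.of_compactSpace g)
  have hψ (ψ : AddChar (A ⧸ H) ℂ) : Continuous fun y : A => ψ (y : A ⧸ H) :=
    (continuous_of_discreteTopology (f := ψ)).comp hmk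
  set k : A → ℝ := (H : Set A).indicator fun _ => (H.index : ℝ) with hk
  have hkc : Continuous k :=
    IsClopen.continuous_indicator ⟨H.isClosed_of_isOpen hH, hH⟩ continuous_const
  have hk0 (y : A) : 0 ≤ k y := indicator_nonneg (fun _ _ => by positivity) y
  have hk1 : ∫ y, k (y - x) ∂μ = 1 := by
    rw [integral_sub_right_eq_self k x, hk, integral_indicator_const _ hH.measurableSet]
    have := H.index_mul_measure hH.measurableSet μ
    rw [measure_univ] at this
    have := congrArg ENNReal.toReal this
    simpa [Measure.real, mul_comm] using this
  have hkc' : Continuous fun y => k (y - x) := hkc.comp (continuous_id.sub continuous_const)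
  have hsum (y : A) : ∑ ψ : AddChar (A ⧸ H) ℂ,
      (starRingEnd ℂ) (ψ (y : A ⧸ H)) * ψ (x : A ⧸ H) = (k (y - x) : ℂ) := by
    have h1 (ψ : AddChar (A ⧸ H) ℂ) : (starRingEnd ℂ) (ψ (y : A ⧸ H)) * ψ (x : A ⧸ H)
        = ψ ((x - y : A) : A ⧸ H) := by
      rw [← AddChar.map_neg_eq_conj, ← AddChar.map_add_eq_mul, QuotientAddGroup.mk_sub,
        neg_add_eq_sub]
    simp_rw [h1, AddChar.sum_apply_eq_ite, QuotientAddGroup.eq_zero_iff, hk, indicator_apply,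
      SetLike.mem_coe, ← H.sub_mem_comm_iff (a := x), index, Nat.card_eq_fintype_card]
    split_ifs <;> simp
  have hF : ∑ ψ : AddChar (A ⧸ H) ℂ,
      (∫ y, f y * (starRingEnd ℂ) (ψ (y : A ⧸ H)) ∂μ) * ψ (x : A ⧸ H)
      = ∫ y, f y * k (y - x) ∂μ := by
    simp_rw [← hsum, Finset.mul_sum, ← mul_assoc]
    rw [integral_finsetSum _ fun ψ _ => hint
      (fun y => f y * (starRingEnd ℂ) (ψ (y : A ⧸ H)) * ψ (x : A ⧸ H))
      ((hf.mul (Complex.continuous_conj.comp (hψ ψ))).mul continuous_const)]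
    simp_rw [integral_mul_const]
  have hfx : ∫ y, f x * k (y - x) ∂μ = f x := by
    rw [integral_const_mul, integral_complex_ofReal, hk1, Complex.ofReal_one, mul_one]
  have hkcC : Continuous fun y => (k (y - x) : ℂ) := Complex.continuous_ofReal.comp hkc'
  have hdiff : ∫ y, (f y * k (y - x) - f x * k (y - x)) ∂μ = ∫ y, f y * k (y - x) ∂μ - f x := by
    rw [integral_sub (hint (fun y => f y * k (y - x)) (hf.mul hkcC))
      (hint (fun y => f x * k (y - x)) (continuous_const.mul hkcC)), hfx]
  rw [hF, ← hdiff]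
  calc ‖∫ y, (f y * k (y - x) - f x * k (y - x)) ∂μ‖
      ≤ ∫ y, ε * k (y - x) ∂μ := by
        refine norm_integral_le_of_norm_le ((continuous_const.mul
          hkc').integrable_of_hasCompactSupport (HasCompactSupport.of_compactSpace _))
          (.of_forall fun y => ?_)
        rw [← sub_mul, norm_mul, Complex.norm_real, Real.norm_of_nonneg (hk0 _)]
        by_cases hy : y - x ∈ H
        · exact mul_le_mul_of_nonneg_right (hε y hy) (hk0 _)
        · simp [hk, hy]
    _ = ε := by rw [integral_const_mul, hk1, mul_one]

end AddSubgroup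

namespace NAKoksma

section Discs

variable {K : Type*} [NontriviallyNormedField K] [IsUltrametricDist K] {q : ℕ} {π : RoI K}

lemma norm_le_one (x : RoI K) : ‖(x : K)‖ ≤ 1 := x.2

instance [LocallyCompactSpace K] : CompactSpace (RoI K) := by
  have := ProperSpace.of_locallyCompactSpace K (E := K)
  have h : ((RoI K : Set K)) = Metric.closedBall 0 1 := by
    ext x
    simp [RoI]
  exact isCompact_iff_compactSpace.mp (h ▸ isCompact_closedBall (0 : K) 1)

/-- The ideal generated by `π ^ n` is the disc of radius `q ^ (-n)` around zero. -/
lemma pow_dvd_iff_norm_le (hq : 1 < q) (hπ : ‖(π : K)‖ = (q : ℝ)⁻¹) (n : ℕ) (x : RoI K) :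
    π ^ n ∣ x ↔ ‖(x : K)‖ ≤ (q : ℝ) ^ (-(n : ℤ)) := by
  have hq0 : (0 : ℝ) < q := by positivity
  have hnorm : ‖(π : K) ^ n‖ = (q : ℝ) ^ (-(n : ℤ)) := by
    rw [norm_pow, hπ, zpow_neg, zpow_natCast, inv_pow]
  have hpos : 0 < ‖(π : K) ^ n‖ := by rw [hnorm]; positivity
  constructor
  · rintro ⟨y, rfl⟩
    rw [Subring.coe_mul, Subring.coe_pow, norm_mul, hnorm]
    exact mul_le_of_le_one_right (by positivity) (norm_le_one y)
  · intro hx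
    refine ⟨⟨(x : K) / (π : K) ^ n, ?_⟩, ?_⟩
    · change ‖(x : K) / (π : K) ^ n‖ ≤ 1
      rw [norm_div, div_le_one hpos, hnorm]
      exact hx
    · ext
      rw [Subring.coe_mul, Subring.coe_pow, mul_div_cancel₀ _ (norm_pos_iff.mp hpos)]

lemma mem_disc_iff_pow_dvd_sub (hq : 1 < q) (hπ : ‖(π : K)‖ = (q : ℝ)⁻¹) (n : ℕ) (a x : RoI K) :
    x ∈ disc K q a n ↔ π ^ n ∣ x - a := by
  rw [pow_dvd_iff_norm_le hq hπ]
  rfl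

lemma isOpen_span_pow (hq : 1 < q) (hπ : ‖(π : K)‖ = (q : ℝ)⁻¹) (n : ℕ) :
    IsOpen ((Ideal.span {π ^ n}).toAddSubgroup : Set (RoI K)) := by
  refine AddSubgroup.isOpen_of_mem_nhds _ (g := 0)
    (Filter.mem_of_superset (Metric.closedBall_mem_nhds 0
      (show (0 : ℝ) < (q : ℝ) ^ (-(n : ℤ)) by positivity)) fun x hx => ?_)
  rw [mem_closedBall_zero_iff] at hx
  exact Ideal.mem_span_singleton.mpr ((pow_dvd_iff_norm_le hq hπ n x).mpr hx)

/-- Every neighbourhood of a point contains a disc around that point. -/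
lemma exists_pow_dvd_sub_imp_mem (hq : 1 < q) (hπ : ‖(π : K)‖ = (q : ℝ)⁻¹) {x : RoI K}
    {s : Set (RoI K)} (hs : s ∈ 𝓝 x) : ∃ m : ℕ, ∀ y, π ^ m ∣ y - x → y ∈ s := by
  obtain ⟨ε, hε, hs⟩ := Metric.mem_nhds_iff.mp hs
  obtain ⟨m, hm⟩ := exists_pow_lt_of_lt_one hε
    (inv_lt_one_of_one_lt₀ (show (1 : ℝ) < q by exact_mod_cast hq))
  refine ⟨m, fun y hy => hs ?_⟩
  rw [Metric.mem_ball, dist_eq_norm]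
  refine lt_of_le_of_lt ((pow_dvd_iff_norm_le hq hπ m _).mp hy) ?_
  rwa [zpow_neg, zpow_natCast, ← inv_pow]

lemma exists_finset_card_le_pow_dvd_sub (hq : 1 < q)
    (hres : Nat.card (RoI K ⧸ (Ideal.span {π} : Ideal (RoI K))) = q) (m : ℕ) :
    ∃ S : Finset (RoI K), S.card ≤ q ^ m ∧ ∀ x, ∃ s ∈ S, π ^ m ∣ x - s := by
  classical
  have : Finite (RoI K ⧸ (Ideal.span {π} : Ideal (RoI K))) :=
    Nat.finite_of_card_ne_zero (by lia)
  have := Fintype.ofFinite (RoI K ⧸ (Ideal.span {π} : Ideal (RoI K)))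
  induction m with
  | zero => exact ⟨{0}, by simp, fun x => ⟨0, by simp, by simp⟩⟩
  | succ m ih =>
    obtain ⟨S, hS, hcov⟩ := ih
    refine ⟨(S ×ˢ Finset.univ).image
      fun p : RoI K × (RoI K ⧸ (Ideal.span {π} : Ideal (RoI K))) => p.1 + π ^ m * p.2.out,
      ?_, fun x => ?_⟩
    · refine Finset.card_image_le.trans ?_
      rw [Finset.card_product, Finset.card_univ, ← Nat.card_eq_fintype_card, hres, pow_succ]
      exact Nat.mul_le_mul_right q hS
    · obtain ⟨s, hs, y, hy⟩ := hcov x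
      refine ⟨_, Finset.mem_image_of_mem _
        (Finset.mk_mem_product hs (Finset.mem_univ (Ideal.Quotient.mk _ y))), ?_⟩
      have h : π ∣ y - (Ideal.Quotient.mk (Ideal.span {π}) y).out := by
        rw [← Ideal.mem_span_singleton, ← Ideal.Quotient.mk_eq_mk_iff_sub_mem]
        exact (Quotient.out_eq _).symm
      rw [← sub_sub, hy, ← mul_sub, pow_succ]
      exact mul_dvd_mul_left _ h

lemma finite_quotient_span_pow (hq : 1 < q)
    (hres : Nat.card (RoI K ⧸ (Ideal.span {π} : Ideal (RoI K))) = q) (m : ℕ) :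
    Finite (RoI K ⧸ (Ideal.span {π ^ m}).toAddSubgroup) := by
  obtain ⟨S, -, hS⟩ := exists_finset_card_le_pow_dvd_sub hq hres m
  refine Finite.of_surjective
    (fun s : S => ((s : RoI K) : RoI K ⧸ (Ideal.span {π ^ m}).toAddSubgroup)) fun x => ?_
  induction x using QuotientAddGroup.induction_on with
  | H x =>
    obtain ⟨s, hs, h⟩ := hS x
    refine ⟨⟨s, hs⟩, QuotientAddGroup.eq.mpr ?_⟩
    rw [neg_add_eq_sub]
    exact Ideal.mem_span_singleton.mpr h

/-- Disjoint discs of radius at least `q ^ (-m)` number at most `q ^ m`. -/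
lemma card_le_of_pairwiseDisjoint_disc (hq : 1 < q) (hπ : ‖(π : K)‖ = (q : ℝ)⁻¹)
    (hres : Nat.card (RoI K ⧸ (Ideal.span {π} : Ideal (RoI K))) = q) (m : ℕ)
    (P : Finset (Set (RoI K))) (hP : (P : Set (Set (RoI K))).PairwiseDisjoint id)
    (hdisc : ∀ D ∈ P, ∃ (a : RoI K) (n : ℕ), n ≤ m ∧ D = disc K q a n) : P.card ≤ q ^ m := by
  obtain ⟨S, hS, hcov⟩ := exists_finset_card_le_pow_dvd_sub hq hres m
  have h (D : Set (RoI K)) : ∃ s, D ∈ P → s ∈ S ∧ s ∈ D := by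
    by_cases hD : D ∈ P
    · obtain ⟨a, n, hn, rfl⟩ := hdisc D hD
      obtain ⟨s, hs, hd⟩ := hcov a
      refine ⟨s, fun _ => ⟨hs, ?_⟩⟩
      rw [mem_disc_iff_pow_dvd_sub hq hπ, dvd_sub_comm]
      exact (pow_dvd_pow π hn).trans hd
    · exact ⟨0, fun h => (hD h).elim⟩
  choose s hs using h
  refine (Finset.card_le_card_of_injOn s (fun D hD => (hs D hD).1) fun D hD E hE hDE => ?_).trans hS
  exact hP.elim_set hD hE (s D) (hs D hD).2 (hDE ▸ (hs E hE).2)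

end Discs

section Characters

variable {K : Type*} [NontriviallyNormedField K] [IsUltrametricDist K] {q : ℕ} {π : RoI K}

lemma apply_eq_one_of_pow_charLevel_dvd (hq : 1 < q) (hπ : ‖(π : K)‖ = (q : ℝ)⁻¹)
    {γ : AddChar (RoI K) Circle} (hγ : Continuous γ) {x : RoI K}
    (hx : π ^ charLevel K π γ ∣ x) : γ x = 1 := by
  have hne : {l : ℕ | ∀ y : RoI K, γ (π ^ l * y) = 1}.Nonempty := by
    have hU : γ ⁻¹' Circle.centeredArc (Real.pi / 2) ∈ 𝓝 (0 : RoI K) := by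
      refine ((Circle.isOpen_centeredArc _).preimage hγ).mem_nhds ?_
      rw [mem_preimage, AddChar.map_zero_eq_one,
        Circle.mem_centeredArc (by linarith [Real.pi_pos])]
      simp [Real.pi_pos]
    obtain ⟨m, hm⟩ := exists_pow_dvd_sub_imp_mem hq hπ hU
    refine ⟨m, fun y => Circle.eq_one_of_forall_pow_mem_centeredArc_pi_div_two fun n _ => ?_⟩
    rw [← AddChar.map_nsmul_eq_pow]
    refine hm _ ?_
    rw [sub_zero, nsmul_eq_mul, mul_left_comm]
    exact dvd_mul_right _ _
  obtain ⟨y, rfl⟩ := hx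
  exact Nat.sInf_mem hne y

lemma charLevel_one : charLevel K π 1 = 0 :=
  Nat.sInf_eq_zero.mpr (.inl fun _ => AddChar.one_apply _)

variable [MeasurableSpace K] [LocallyCompactSpace K] [BorelSpace K]

/-- The oscillation of a continuous function on a disc of radius `q ^ (-n)` is controlled by its
Fourier coefficients at the characters of level larger than `n`. -/
lemma ofReal_sub_le_tsum_fourierCoeff (hq : 1 < q) (hπ : ‖(π : K)‖ = (q : ℝ)⁻¹)
    (hres : Nat.card (RoI K ⧸ (Ideal.span {π} : Ideal (RoI K))) = q)
    (μ : Measure (RoI K)) [IsProbabilityMeasure μ] [μ.IsAddHaarMeasure]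
    {f : RoI K → ℝ} (hf : Continuous f) {n : ℕ} {x y : RoI K} (hxy : π ^ n ∣ x - y) :
    ENNReal.ofReal (f x - f y) ≤
      ∑' γ : {γ : AddChar (RoI K) Circle // Continuous ⇑γ ∧ γ ≠ 1},
        if n < charLevel K π γ.1 then
          ENNReal.ofReal (2 * ‖fourierCoeff K μ (fun x => (f x : ℂ)) γ.1‖) else 0 := by
  classical
  set c : AddChar (RoI K) Circle → ℂ := fourierCoeff K μ (fun x => (f x : ℂ))
  set b : AddChar (RoI K) Circle → ℝ := fun γ => if n < charLevel K π γ then 2 * ‖c γ‖ else 0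
    with hb
  have hb0 (γ) : 0 ≤ b γ := by
    rw [hb]; dsimp only; split_ifs <;> positivity
  refine ENNReal.le_of_forall_pos_le_add fun ε hε _ => ?_
  have hε2 : (0 : ℝ) < ε / 2 := half_pos hε
  obtain ⟨m₁, hm₁⟩ := exists_pow_dvd_sub_imp_mem hq hπ
    (hf.continuousAt (x := x) (Metric.closedBall_mem_nhds _ hε2))
  obtain ⟨m₂, hm₂⟩ := exists_pow_dvd_sub_imp_mem hq hπ
    (hf.continuousAt (x := y) (Metric.closedBall_mem_nhds _ hε2))
  set m := max m₁ m₂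
  set H : AddSubgroup (RoI K) := (Ideal.span {π ^ m}).toAddSubgroup
  have hHo : IsOpen (H : Set (RoI K)) := isOpen_span_pow hq hπ m
  have hfin : Finite (RoI K ⧸ H) := finite_quotient_span_pow hq hres m
  have hmem {z : RoI K} (hz : z ∈ H) : π ^ m ∣ z := Ideal.mem_span_singleton.mp hz
  set γ : AddChar (RoI K ⧸ H) ℂ → AddChar (RoI K) Circle := fun ψ =>
    (AddChar.circleEquivComplex.symm ψ).compAddMonoidHom (QuotientAddGroup.mk' H)
  have hγ (ψ) (z : RoI K) : ((γ ψ z : Circle) : ℂ) = ψ (z : RoI K ⧸ H) := rfl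
  have hγinj : Function.Injective γ :=
    (AddChar.compAddMonoidHom_injective_left _ (QuotientAddGroup.mk'_surjective H)).comp
      AddChar.circleEquivComplex.symm.injective
  have hγc (ψ) : Continuous (γ ψ) := by
    have : DiscreteTopology (RoI K ⧸ H) := QuotientAddGroup.discreteTopology hHo
    exact (continuous_of_discreteTopology (f := AddChar.circleEquivComplex.symm ψ)).comp
      continuous_quotient_mk'
  set F : RoI K → ℂ := fun z => ∑ ψ : AddChar (RoI K ⧸ H) ℂ, c (γ ψ) * (γ ψ z : ℂ)
  have hF {z : RoI K} (hz : ∀ w, w - z ∈ H → |f w - f z| ≤ ε / 2) : ‖F z - f z‖ ≤ ε / 2 :=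
    H.norm_sum_integral_mul_addChar_sub_le μ hHo (Complex.continuous_ofReal.comp hf)
      fun w hw => by simpa [← Complex.ofReal_sub] using hz w hw
  have hx : ‖F x - f x‖ ≤ ε / 2 := hF fun w hw =>
    hm₁ w ((pow_dvd_pow π (le_max_left m₁ m₂)).trans (hmem hw))
  have hy : ‖F y - f y‖ ≤ ε / 2 := hF fun w hw =>
    hm₂ w ((pow_dvd_pow π (le_max_right m₁ m₂)).trans (hmem hw))
  have hterm (ψ) : ‖c (γ ψ) * (γ ψ x : ℂ) - c (γ ψ) * (γ ψ y : ℂ)‖ ≤ b (γ ψ) := by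
    rw [← mul_sub, norm_mul, hb]
    dsimp only
    split_ifs with h
    · rw [mul_comm]
      refine mul_le_mul_of_nonneg_right ((norm_sub_le _ _).trans ?_) (norm_nonneg _)
      rw [Circle.norm_coe, Circle.norm_coe]
      norm_num
    · have h1 : γ ψ (x - y) = 1 := apply_eq_one_of_pow_charLevel_dvd hq hπ (hγc ψ)
        ((pow_dvd_pow π (not_lt.mp h)).trans hxy)
      have h2 : γ ψ x = γ ψ y := by
        rw [← sub_add_cancel x y, AddChar.map_add_eq_mul, h1, one_mul]
      simp [h2]
  have hFxy : ‖F x - F y‖ ≤ ∑ ψ, b (γ ψ) := by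
    rw [← Finset.sum_sub_distrib]
    exact norm_sum_le_of_le _ fun ψ _ => hterm ψ
  have hreal : f x - f y ≤ ∑ ψ, b (γ ψ) + ε := by
    have h1 : f x - f y ≤ ‖(f x : ℂ) - f y‖ := by
      rw [← Complex.ofReal_sub, Complex.norm_real]
      exact le_abs_self _
    have h2 : (f x : ℂ) - f y = (F x - F y) - (F x - f x) + (F y - f y) := by ring
    have h3 := norm_add_le ((F x - F y) - (F x - f x)) (F y - f y)
    have h4 := norm_sub_le (F x - F y) (F x - f x)
    rw [h2] at h1
    linarith
  have hsum : ENNReal.ofReal (∑ ψ, b (γ ψ)) ≤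
      ∑' γ : {γ : AddChar (RoI K) Circle // Continuous ⇑γ ∧ γ ≠ 1}, ENNReal.ofReal (b γ.1) := by
    rw [ENNReal.ofReal_sum_of_nonneg fun ψ _ => hb0 _, ← tsum_fintype (L := .unconditional _)]
    have hind (ψ) : ENNReal.ofReal (b (γ ψ)) =
        {γ : AddChar (RoI K) Circle | Continuous ⇑γ ∧ γ ≠ 1}.indicator
          (fun γ => ENNReal.ofReal (b γ)) (γ ψ) := by
      by_cases h : γ ψ = 1
      · simp [hb, h, charLevel_one]
      · have hS : γ ψ ∈ {γ : AddChar (RoI K) Circle | Continuous ⇑γ ∧ γ ≠ 1} := ⟨hγc ψ, h⟩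
        rw [indicator_of_mem hS]
    simp_rw [hind]
    exact (ENNReal.tsum_comp_le_tsum_of_injective hγinj _).trans_eq
      (tsum_subtype {γ : AddChar (RoI K) Circle | Continuous ⇑γ ∧ γ ≠ 1} _).symm
  calc ENNReal.ofReal (f x - f y) ≤ ENNReal.ofReal (∑ ψ, b (γ ψ) + ε) :=
        ENNReal.ofReal_le_ofReal hreal
    _ ≤ ENNReal.ofReal (∑ ψ, b (γ ψ)) + ε := by
        refine ENNReal.ofReal_add_le.trans_eq ?_
        rw [ENNReal.ofReal_coe_nnreal]
    _ ≤ _ := by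
        refine add_le_add_left (hsum.trans_eq (tsum_congr fun γ => ?_)) _
        rw [hb]
        dsimp only
        split_ifs <;> simp

end Characters

variable (K : Type*) [NontriviallyNormedField K] [IsUltrametricDist K]

variable (q : ℕ)

variable [MeasurableSpace K]

variable (π : RoI K)

variable [LocallyCompactSpace K] [BorelSpace K]

theorem VTaib_le_VFourier
    (hq : 1 < q)
    (hπ : ‖(π : K)‖ = (q : ℝ)⁻¹)
    (hunif : ∀ x : RoI K, ‖(x : K)‖ < 1 → ‖(x : K)‖ ≤ ‖(π : K)‖)
    (hres : Nat.card (↥(RoI K) ⧸ (Ideal.span {π} : Ideal ↥(RoI K))) = q)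
    (μ : Measure (RoI K)) [IsProbabilityMeasure μ] [μ.IsAddHaarMeasure]
    (f : RoI K → ℝ) (hf : Continuous f) :
    VTaib K q f ≤ 2 / (q : ℝ≥0∞) * VFourier K q π μ f := by
  classical
  refine iSup_le fun ⟨P, hdisc, hdisj, _⟩ => ?_
  have hdisc' (D : Set (RoI K)) : ∃ (a : RoI K) (n : ℕ), D ∈ P → D = disc K q a n := by
    by_cases hD : D ∈ P
    · obtain ⟨a, n, h⟩ := hdisc D hD
      exact ⟨a, n, fun _ => h⟩
    · exact ⟨0, 0, fun h => (hD h).elim⟩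
  choose a n hD using hdisc'
  set c : AddChar (RoI K) Circle → ℂ := fourierCoeff K μ (fun x => (f x : ℂ))
  have hosc : ∀ D ∈ P, ⨆ x ∈ D, ⨆ y ∈ D, ENNReal.ofReal (f x - f y) ≤
      ∑' γ : {γ : AddChar (RoI K) Circle // Continuous ⇑γ ∧ γ ≠ 1},
        if n D < charLevel K π γ.1 then ENNReal.ofReal (2 * ‖c γ.1‖) else 0 := by
    refine fun D hDP => iSup₂_le fun x hx => iSup₂_le fun y hy =>
      ofReal_sub_le_tsum_fourierCoeff hq hπ hres μ hf ?_
    rw [hD D hDP, mem_disc_iff_pow_dvd_sub hq hπ] at hx hy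
    simpa using dvd_sub hx hy
  refine (Finset.sum_le_sum hosc).trans ?_
  rw [← Summable.tsum_finsetSum fun _ _ => ENNReal.summable, VFourier, ← ENNReal.tsum_mul_left]
  refine ENNReal.tsum_le_tsum fun γ => ?_
  rw [← Finset.sum_filter, Finset.sum_const, nsmul_eq_mul]
  obtain hl | ⟨l, hl⟩ : charLevel K π γ.1 = 0 ∨ ∃ l, charLevel K π γ.1 = l + 1 := by
    cases charLevel K π γ.1 <;> simp
  · simp [hl]
  have hcard : (P.filter fun D => n D < charLevel K π γ.1).card ≤ q ^ l := by
    refine card_le_of_pairwiseDisjoint_disc hq hπ hres l _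
      (hdisj.subset (Finset.coe_subset.mpr (Finset.filter_subset _ _))) fun D hD' => ?_
    rw [Finset.mem_filter] at hD'
    exact ⟨a D, n D, by lia, hD D hD'.1⟩
  have hq0 : (q : ℝ≥0∞) ≠ 0 := by exact_mod_cast (by lia : q ≠ 0)
  calc _ ≤ ((q ^ l : ℕ) : ℝ≥0∞) * ENNReal.ofReal (2 * ‖c γ.1‖) := by gcongr
    _ = 2 / (q : ℝ≥0∞) * ENNReal.ofReal ((q : ℝ) ^ charLevel K π γ.1 * ‖c γ.1‖) := by
      rw [hl, ENNReal.ofReal_mul (by positivity), ENNReal.ofReal_mul (by positivity),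
        ENNReal.ofReal_pow (by positivity), ENNReal.ofReal_natCast, ENNReal.ofReal_ofNat,
        pow_succ, Nat.cast_pow, div_eq_mul_inv]
      calc (q : ℝ≥0∞) ^ l * (2 * ENNReal.ofReal ‖c γ.1‖)
          = ((q : ℝ≥0∞)⁻¹ * q) * ((q : ℝ≥0∞) ^ l * (2 * ENNReal.ofReal ‖c γ.1‖)) := by
            rw [ENNReal.inv_mul_cancel hq0 (ENNReal.natCast_ne_top q), one_mul]
        _ = _ := by ring

end NAKoksma
end
end
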